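/- Let T : [0,1] → [0,1] be piecewise C² with respect to a finite partition 𝒫 of [0,1] into intervals (on each I ∈ 𝒫, T extends to a C² map on a neighbourhood of the closure of I), uniformly expanding (|T′| ≥ λ > 1 everywhere), and weakly covering: there is N₀ ∈ ℕ such that for every I ∈ 𝒫 one has ⋃_{k=0}^{N₀} T^k(I) ⊃ [0,1] ∖ W, where W is the set of points whose forward orbit never hits the set of endpoints of the partition intervals. Let α ≥ 1 and r_n = n^{−α}. Then for Lebesgue-almost every x ∈ [0,1], the Hausdorff dimension of E(x,r) equals 1/α. -/

import Mathlib

open MeasureTheory Filter Set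

/-- `E(x,r)`: the set of `y ∈ [0,1]` such that `|Tⁿ x − y| < r n` for infinitely many `n`. -/
def hitSet (T : ℝ → ℝ) (x : ℝ) (r : ℕ → ℝ) : Set ℝ :=
  {y ∈ Set.Icc (0 : ℝ) 1 | ∃ᶠ n in Filter.atTop, |T^[n] x - y| < r n}


lemma upper_dim (x : ℕ → ℝ) (α : ℝ) (hα : 1 ≤ α) :
    dimH {y : ℝ | ∃ᶠ n in atTop, |x n - y| < (n : ℝ) ^ (-α)} ≤ ENNReal.ofReal (1 / α) := by
  have hα0 : 0 < α := by linarith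
  by_contra hcon
  push Not at hcon
  obtain ⟨d, hd1, hd2⟩ := ENNReal.lt_iff_exists_nnreal_btwn.1 hcon
  have hd : 1 / α < (d : ℝ) := by
    rw [← ENNReal.ofReal_coe_nnreal] at hd1
    exact (ENNReal.ofReal_lt_ofReal_iff_of_nonneg (by positivity)).1 hd1
  have hd0 : 0 < (d : ℝ) := lt_trans (by positivity) hd
  have hαd : 1 < α * d := by
    rw [div_lt_iff₀ hα0] at hd; linarith
  refine absurd hd2 (not_lt.2 (dimH_le_of_hausdorffMeasure_ne_top ?_))
  set f : ℕ → ENNReal := fun n => ENNReal.ofReal (2 * (n : ℝ) ^ (-α)) ^ (d : ℝ) with hf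
  have hfs : ∑' n, f n ≠ ⊤ := by
    have : ∀ n, f n = ENNReal.ofReal ((2 : ℝ) ^ (d : ℝ) * (n : ℝ) ^ (-(α * d))) := by
      intro n
      rw [hf]
      simp only
      rw [ENNReal.ofReal_rpow_of_nonneg (by positivity) hd0.le,
        Real.mul_rpow (by norm_num) (by positivity), ← Real.rpow_mul (by positivity)]
      ring_nf
    simp_rw [this]
    exact ((Real.summable_nat_rpow.2 (by linarith)).mul_left _).tsum_ofReal_ne_top
  have htail := ENNReal.tendsto_sum_nat_add f hfs
  have key := Measure.hausdorffMeasure_le_liminf_tsum (d : ℝ)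
    {y : ℝ | ∃ᶠ n in atTop, |x n - y| < (n : ℝ) ^ (-α)} (l := atTop)
    (fun n : ℕ => ENNReal.ofReal (2 * (n : ℝ) ^ (-α)))
    (by
      have h1 : Tendsto (fun n : ℕ => 2 * (n : ℝ) ^ (-α)) atTop (nhds (2 * 0)) :=
        ((tendsto_rpow_neg_atTop hα0).comp tendsto_natCast_atTop_atTop).const_mul 2
      have := ENNReal.tendsto_ofReal h1
      simpa using this)
    (fun n i : ℕ => Metric.ball (x (i + n)) (((i + n : ℕ) : ℝ) ^ (-α)))
    (by
      filter_upwards [eventually_ge_atTop 1] with n hn i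
      rw [Real.ball_eq_Ioo, Real.ediam_Ioo]
      apply ENNReal.ofReal_le_ofReal
      have : (((i + n : ℕ) : ℝ) ^ (-α)) ≤ (n : ℝ) ^ (-α) := by
        apply Real.rpow_le_rpow_of_nonpos (by positivity) (by push_cast; linarith [(Nat.cast_nonneg i : (0:ℝ) ≤ i)]) (by linarith)
      linarith)
    (by
      refine Eventually.of_forall fun n y hy => ?_
      obtain ⟨k, hk, hk2⟩ := (frequently_atTop.1 hy) n
      refine mem_iUnion.2 ⟨k - n, ?_⟩
      rw [Nat.sub_add_cancel hk, Metric.mem_ball, dist_comm, Real.dist_eq]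
      exact hk2)
  have : liminf (fun n : ℕ => ∑' i : ℕ, Metric.ediam (Metric.ball (x (i + n)) (((i + n : ℕ) : ℝ) ^ (-α))) ^ (d : ℝ)) atTop = 0 := by
    rw [← htail.liminf_eq]
    have e : ∀ a b : ℝ, a + b - (a - b) = 2 * b := by intros; ring
    simp only [Real.ball_eq_Ioo, Real.ediam_Ioo, hf, e]
  rw [this] at key
  exact ne_top_of_le_ne_top (by simp) key


structure CStage where
  M : ℕ
  ρ : ℝ
  c : ℕ → ℝ

def CStage.Inv (u v s C0 : ℝ) (S : CStage) : Prop :=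
  1 ≤ S.M ∧ 0 < S.ρ ∧ 1 ≤ C0 * (S.M * S.ρ ^ s) ∧ ∀ a, Icc (S.c a - S.ρ) (S.c a + S.ρ) ⊆ Icc u v

def CStage.Next (x : ℕ → ℝ) (α : ℝ) (k : ℕ) (S S' : CStage) : Prop :=
  ∃ m : ℕ, 2 ≤ m ∧ S'.M = S.M * m ∧ S'.ρ ≤ (2 * S.ρ / m) / 8 ∧
    ∀ a : ℕ, |S'.c a - (S.c (a / m) - S.ρ + (((a % m : ℕ) : ℝ) + 1 / 2) * (2 * S.ρ / m))|
        ≤ (2 * S.ρ / m) / 8 ∧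
      ∃ n, k ≤ n ∧ ∀ z, |z - S'.c a| ≤ S'.ρ → |x n - z| < (n : ℝ) ^ (-α)

lemma cstage_step (x : ℕ → ℝ) (u v α s C0 : ℝ) (hα : 1 ≤ α) (hs : 0 < s) (hs1 : s ≤ 1)
    (hC0 : 1 ≤ C0)
    (hyp : ∀ η > 0, ∀ n0 : ℕ, ∃ N : ℕ, ∃ ε > 0, ε * (N : ℝ) ^ (α * s) ≤ η ∧ (N : ℝ) ^ (-α) ≤ ε ∧
      ε ≤ η ∧ ∀ y ∈ Icc u v, ∃ n, n0 ≤ n ∧ n ≤ N ∧ |x n - y| ≤ ε)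
    (k : ℕ) (S : CStage) (hS : S.Inv u v s C0) : ∃ S', CStage.Inv u v s C0 S' ∧ S.Next x α k S' := by
  obtain ⟨hM, hρ, hinv, hsub⟩ := hS
  obtain ⟨N, ε, hε, h1, h2, h3, h4⟩ := hyp (S.ρ / 16) (by positivity) (k + 1)
  have hN : 1 ≤ N := by
    obtain ⟨n, hn, hn2, _⟩ := h4 (S.c 0) (hsub 0 ⟨by linarith, by linarith⟩)
    omega
  have hNr : (0 : ℝ) < N := by exact_mod_cast hN
  set m := ⌊S.ρ / (4 * ε)⌋₊ with hm
  have hq : 4 ≤ S.ρ / (4 * ε) := by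
    rw [le_div_iff₀ (by positivity)]; linarith
  have hm2 : 2 ≤ m := by
    apply Nat.le_floor; push_cast; linarith
  have hmr : (2 : ℝ) ≤ m := by exact_mod_cast hm2
  have hmle : (m : ℝ) ≤ S.ρ / (4 * ε) := Nat.floor_le (by positivity)
  have hmge : S.ρ / (8 * ε) ≤ m := by
    have := Nat.lt_floor_add_one (S.ρ / (4 * ε))
    rw [← hm] at this
    have e : S.ρ / (8 * ε) = (S.ρ / (4 * ε)) / 2 := by field_simp; norm_num
    rw [e]; linarith
  have hγ : ε ≤ (2 * S.ρ / m) / 8 := by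
    rw [div_div, le_div_iff₀ (by positivity)]
    rw [le_div_iff₀ (by positivity)] at hmle
    linarith
  set γ := 2 * S.ρ / m with hγd
  have hγ0 : 0 < γ := by positivity
  have hmγ : m * γ = 2 * S.ρ := by rw [hγd]; field_simp
  set y : ℕ → ℝ := fun a => S.c (a / m) - S.ρ + (((a % m : ℕ) : ℝ) + 1 / 2) * γ with hy
  have hmod : ∀ a : ℕ, 0 ≤ ((a % m : ℕ) : ℝ) ∧ ((a % m : ℕ) : ℝ) + 1 ≤ m := by
    intro a
    refine ⟨by positivity, ?_⟩
    have := Nat.mod_lt a (show 0 < m by omega)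
    exact_mod_cast this
  have hyin : ∀ a, S.c (a / m) - S.ρ + γ / 2 ≤ y a ∧ y a ≤ S.c (a / m) + S.ρ - γ / 2 := by
    intro a
    obtain ⟨b1, b2⟩ := hmod a
    constructor
    · simp only [hy]; nlinarith
    · simp only [hy]; nlinarith
  have hyJ : ∀ a, y a ∈ Icc u v := fun a => hsub (a / m) ⟨by linarith [hyin a], by linarith [hyin a]⟩
  choose n hn1 hn2 hn3 using fun a => h4 (y a) (hyJ a)
  have hρ' : (N : ℝ) ^ (-α) / 2 ≤ γ / 8 := by linarith
  have hNα : 0 < (N : ℝ) ^ (-α) := by positivity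
  refine ⟨⟨S.M * m, (N : ℝ) ^ (-α) / 2, fun a => x (n a)⟩, ⟨?_, by positivity, ?_, ?_⟩, m, hm2, rfl, hρ', ?_⟩
  · exact Nat.one_le_iff_ne_zero.2 (by positivity)
  · push_cast
    have hMr : (1 : ℝ) ≤ S.M := by exact_mod_cast hM
    have e1 : ((N : ℝ) ^ (-α) / 2) ^ s = ((N : ℝ) ^ (α * s))⁻¹ / 2 ^ s := by
      rw [Real.div_rpow (by positivity) (by norm_num), ← Real.rpow_mul (by positivity), ← Real.rpow_neg (by positivity)]
      ring_nf
    have e2 : (2 : ℝ) ^ s ≤ 2 := by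
      calc (2 : ℝ) ^ s ≤ 2 ^ (1 : ℝ) := Real.rpow_le_rpow_of_exponent_le (by norm_num) hs1
        _ = 2 := by simp
    have e3 : 1 ≤ m * ((N : ℝ) ^ (-α) / 2) ^ s := by
      rw [e1]
      set P := (N : ℝ) ^ (α * s) with hP
      have hP0 : 0 < P := by positivity
      have : 2 * P ≤ m := by
        refine le_trans ?_ hmge
        rw [le_div_iff₀ (by positivity)]
        nlinarith
      have h2s : (0:ℝ) < 2 ^ s := by positivity
      rw [← mul_div_assoc, le_div_iff₀ h2s, ← div_eq_mul_inv, le_div_iff₀ hP0]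
      nlinarith
    calc (1 : ℝ) = 1 * (1 * 1) := by ring
      _ ≤ C0 * (S.M * (m * ((N : ℝ) ^ (-α) / 2) ^ s)) := by gcongr
      _ = _ := by ring
  · intro a z hz
    have h5 := abs_le.1 (hn3 a)
    have := hyin a
    simp only [mem_Icc] at hz
    exact hsub (a / m) ⟨by linarith, by linarith⟩
  · intro a
    refine ⟨le_trans (hn3 a) hγ, n a, by have := hn1 a; omega, ?_⟩
    intro z hz
    have h0 : (0 : ℝ) < n a := by
      have := hn1 a
      exact_mod_cast (by omega : 0 < n a)
    have : (N : ℝ) ^ (-α) ≤ (n a : ℝ) ^ (-α) :=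
      Real.rpow_le_rpow_of_nonpos h0 (by exact_mod_cast hn2 a) (by linarith)
    simp only at hz
    rw [abs_sub_comm]
    linarith

set_option maxHeartbeats 2000000 in
lemma cantor_lower (x : ℕ → ℝ) (u v α s : ℝ) (huv : u < v) (hα : 1 ≤ α) (hs : 0 < s) (hs1 : s ≤ 1)
    (hyp : ∀ η > 0, ∀ n0 : ℕ, ∃ N : ℕ, ∃ ε > 0, ε * (N : ℝ) ^ (α * s) ≤ η ∧ (N : ℝ) ^ (-α) ≤ ε ∧
      ε ≤ η ∧ ∀ y ∈ Icc u v, ∃ n, n0 ≤ n ∧ n ≤ N ∧ |x n - y| ≤ ε) :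
    ENNReal.ofReal s ≤ dimH {y ∈ Icc u v | ∃ᶠ n in atTop, |x n - y| < (n : ℝ) ^ (-α)} := by
  set ρ0 := (v - u) / 2 with hρ0
  have hρ0p : 0 < ρ0 := by rw [hρ0]; linarith
  set C0 : ℝ := max 1 ((ρ0 ^ s)⁻¹) with hC0
  have hC01 : 1 ≤ C0 := le_max_left _ _
  choose! nx hnx1 hnx2 using cstage_step x u v α s C0 hα hs hs1 hC01 hyp
  set st : ℕ → CStage := fun k => Nat.rec ⟨1, ρ0, fun _ => (u + v) / 2⟩ (fun k S => nx k S) k with hst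
  have st0 : st 0 = ⟨1, ρ0, fun _ => (u + v) / 2⟩ := rfl
  have stS : ∀ k, st (k + 1) = nx k (st k) := fun k => rfl
  have hinv : ∀ k, (st k).Inv u v s C0 := by
    intro k
    induction k with
    | zero =>
      rw [st0]
      refine ⟨le_rfl, hρ0p, ?_, ?_⟩
      · have : (ρ0 ^ s)⁻¹ * ρ0 ^ s = 1 := inv_mul_cancel₀ (by positivity)
        simp only [Nat.cast_one, one_mul]
        rw [← this]
        gcongr
        exact le_max_right _ _
      · intro a z hz
        simp only [mem_Icc] at hz ⊢
        constructor <;> linarith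
    | succ k ih => rw [stS]; exact hnx1 k _ ih
  have hnext : ∀ k, (st k).Next x α k (st (k + 1)) := by
    intro k; rw [stS]; exact hnx2 k _ (hinv k)
  choose m hm2 hM hρ hc using hnext
  have hM2 : ∀ k, 2 ^ k ≤ (st k).M := by
    intro k
    induction k with
    | zero => simp [st0]
    | succ k ih => rw [hM, pow_succ]; exact Nat.mul_le_mul ih (hm2 k)
  have hMpos : ∀ k, (0 : ℝ) < (st k).M := fun k => by exact_mod_cast (hinv k).1
  set A : ℕ → ℝ → ℕ := fun k t => ⌊(st k).M * t⌋₊ with hA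
  have hAdiv : ∀ k t, A (k + 1) t / m k = A k t := by
    intro k t
    simp only [hA]
    rw [hM, ← Nat.floor_div_natCast]
    congr 1
    have : (m k : ℝ) ≠ 0 := by have := hm2 k; positivity
    push_cast
    field_simp
  set I : ℕ → ℝ → Set ℝ := fun k t => Icc ((st k).c (A k t) - (st k).ρ) ((st k).c (A k t) + (st k).ρ) with hI
  -- location
  have hloc : ∀ k t z, z ∈ I (k + 1) t →
      |z - ((st k).c (A k t) - (st k).ρ + (((A (k + 1) t % m k : ℕ) : ℝ) + 1 / 2) * (2 * (st k).ρ / m k))|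
        ≤ (2 * (st k).ρ / m k) / 4 := by
    intro k t z hz
    have h1 := (hc k (A (k + 1) t)).1
    rw [hAdiv] at h1
    have h2 := hρ k
    simp only [hI, mem_Icc] at hz
    rw [abs_le] at h1 ⊢
    constructor <;> linarith
  have hnest : ∀ t k, I (k + 1) t ⊆ I k t := by
    intro t k z hz
    have h1 := abs_le.1 (hloc k t z hz)
    have hmr : (2 : ℝ) ≤ m k := by exact_mod_cast hm2 k
    have hρk := (hinv k).2.1
    have hγ0 : 0 < 2 * (st k).ρ / m k := by positivity
    have hmγ : m k * (2 * (st k).ρ / m k) = 2 * (st k).ρ := by field_simp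
    have hmod : ((A (k + 1) t % m k : ℕ) : ℝ) + 1 ≤ m k := by
      have := Nat.mod_lt (A (k + 1) t) (show 0 < m k by have := hm2 k; omega)
      exact_mod_cast this
    have hmod0 : 0 ≤ ((A (k + 1) t % m k : ℕ) : ℝ) := by positivity
    simp only [hI, mem_Icc]
    constructor <;> nlinarith
  have hne : ∀ t, (⋂ k, I k t).Nonempty := by
    intro t
    refine IsCompact.nonempty_iInter_of_sequence_nonempty_isCompact_isClosed _ (hnest t) ?_ isCompact_Icc (fun k => isClosed_Icc)
    intro k
    have := (hinv k).2.1
    exact nonempty_Icc.2 (by linarith)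
  choose g hg using hne
  have hg' : ∀ t k, g t ∈ I k t := fun t k => mem_iInter.1 (hg t) k
  -- membership
  have hmem : ∀ t, g t ∈ {y ∈ Icc u v | ∃ᶠ n in atTop, |x n - y| < (n : ℝ) ^ (-α)} := by
    intro t
    refine ⟨(hinv 0).2.2.2 _ (hg' t 0), ?_⟩
    rw [frequently_atTop]
    intro k
    obtain ⟨n, hn, h⟩ := (hc k (A (k + 1) t)).2
    refine ⟨n, hn, h _ ?_⟩
    have := hg' t (k + 1)
    simp only [hI, mem_Icc] at this
    rw [abs_le]; constructor <;> linarith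
  -- Holder bound
  have hhold : ∀ t ∈ Ico (0 : ℝ) 1, ∀ t' ∈ Ico (0 : ℝ) 1, |t - t'| ≤ 2 * C0 * |g t - g t'| ^ s := by
    intro t ht t' ht'
    by_cases hall : ∀ k, A k t = A k t'
    · have : t = t' := by
        by_contra hne
        have hpos : 0 < |t - t'| := abs_pos.2 (sub_ne_zero.2 hne)
        obtain ⟨k, hk⟩ := pow_unbounded_of_one_lt (1 / |t - t'|) (one_lt_two)
        have h1 : (2 : ℝ) ^ k ≤ (st k).M := by exact_mod_cast hM2 k
        have h2 := Nat.floor_le (mul_nonneg (hMpos k).le ht.1)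
        have h3 := Nat.lt_floor_add_one ((st k).M * t)
        have h2' := Nat.floor_le (mul_nonneg (hMpos k).le ht'.1)
        have h3' := Nat.lt_floor_add_one ((st k).M * t')
        have h4 := hall k
        simp only [hA] at h4
        rw [h4] at h2 h3
        have h5 : (st k).M * |t - t'| < 1 := by
          rw [← abs_of_pos (hMpos k), ← abs_mul, abs_lt]
          constructor <;> linarith
        rw [div_lt_iff₀ hpos] at hk
        nlinarith
      subst this
      simp [Real.zero_rpow hs.ne']
    · push Not at hall
      have hex : ∃ k, A (k + 1) t ≠ A (k + 1) t' ∧ A k t = A k t' := by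
        classical
        have hfind := Nat.find_spec hall
        have hmin := fun j => Nat.find_min hall (m := j)
        set K := Nat.find hall
        have hA0 : A 0 t = A 0 t' := by
          simp only [hA, st0, Nat.cast_one, one_mul]
          rw [Nat.floor_eq_zero.2 ht.2, Nat.floor_eq_zero.2 ht'.2]
        have hK : K ≠ 0 := by
          intro h; rw [h] at hfind; exact hfind hA0
        obtain ⟨k, hk⟩ := Nat.exists_eq_succ_of_ne_zero hK
        refine ⟨k, by rw [hk] at hfind; exact hfind, ?_⟩
        have := hmin k (by omega)
        push Not at this
        exact this
      obtain ⟨k, hk1, hk2⟩ := hex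
      have hmr : (2 : ℝ) ≤ m k := by exact_mod_cast hm2 k
      have hρk := (hinv k).2.1
      have hI3 := (hinv k).2.2.1
      have hMk := hMpos k
      set ρ := (st k).ρ
      set Mk : ℝ := ((st k).M : ℝ)
      set γ := 2 * ρ / m k with hγ
      have hγ0 : 0 < γ := by positivity
      have l1 := abs_le.1 (hloc k t _ (hg' t (k + 1)))
      have l2 := abs_le.1 (hloc k t' _ (hg' t' (k + 1)))
      rw [← hk2] at l2
      have hdm : A (k + 1) t = m k * A k t + A (k + 1) t % m k := by
        conv_lhs => rw [← Nat.div_add_mod (A (k + 1) t) (m k), hAdiv]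
      have hdm' : A (k + 1) t' = m k * A k t + A (k + 1) t' % m k := by
        conv_lhs => rw [← Nat.div_add_mod (A (k + 1) t') (m k), hAdiv, ← hk2]
      have hlt := Nat.mod_lt (A (k + 1) t) (show 0 < m k by have := hm2 k; omega)
      have hlt' := Nat.mod_lt (A (k + 1) t') (show 0 < m k by have := hm2 k; omega)
      set d := A (k + 1) t % m k
      set d' := A (k + 1) t' % m k
      have hdd : d ≠ d' := by
        intro h; apply hk1; rw [hdm, hdm', h]
      set e : ℝ := |(d : ℝ) - d'| with he
      have he1 : 1 ≤ e := by
        have : (1 : ℤ) ≤ |(d : ℤ) - d'| := Int.one_le_abs (by omega)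
        rw [he]; exact_mod_cast this
      have hem : e ≤ m k := by
        have h1 : (d : ℝ) < m k := by exact_mod_cast hlt
        have h2 : (d' : ℝ) < m k := by exact_mod_cast hlt'
        have h3 : (0 : ℝ) ≤ d := by positivity
        have h4 : (0 : ℝ) ≤ d' := by positivity
        rw [he, abs_le]; constructor <;> linarith
      -- lower bound for g
      have hglow : e * γ / 2 ≤ |g t - g t'| := by
        have h1 : e * γ = |(g t - g t') + ((d - d') * γ - (g t - g t'))| := by
          rw [he, ← abs_of_pos hγ0, ← abs_mul, abs_of_pos hγ0]; congr 1; ring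
        have h2 : |(d - d') * γ - (g t - g t')| ≤ γ / 2 := by
          rw [abs_le]; constructor <;> linarith
        have h3 := abs_add_le (g t - g t') ((d - d') * γ - (g t - g t'))
        nlinarith
      -- upper bound for t
      have htup : Mk * m k * |t - t'| ≤ 2 * e := by
        have e1 : ((st (k + 1)).M : ℝ) = Mk * m k := by rw [hM]; push_cast; rfl
        have h2 := Nat.floor_le (mul_nonneg (hMpos (k+1)).le ht.1)
        have h3 := Nat.lt_floor_add_one ((st (k+1)).M * t)
        have h2' := Nat.floor_le (mul_nonneg (hMpos (k+1)).le ht'.1)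
        have h3' := Nat.lt_floor_add_one ((st (k+1)).M * t')
        have a1 : ((⌊((st (k+1)).M : ℝ) * t⌋₊ : ℕ) : ℝ) = m k * A k t + d := by
          have : ((A (k + 1) t : ℕ) : ℝ) = m k * A k t + d := by
            rw [hdm]; push_cast; rfl
          exact this
        have a2 : ((⌊((st (k+1)).M : ℝ) * t'⌋₊ : ℕ) : ℝ) = m k * A k t + d' := by
          have : ((A (k + 1) t' : ℕ) : ℝ) = m k * A k t + d' := by
            rw [hdm']; push_cast; rfl
          exact this
        rw [a1] at h2 h3
        rw [a2] at h2' h3'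
        rw [e1] at h2 h3 h2' h3'
        have hpos : 0 < Mk * m k := by positivity
        have h5 : Mk * m k * |t - t'| ≤ e + 1 := by
          rw [← abs_of_pos hpos, ← abs_mul, abs_le]
          have b1 := le_abs_self ((d : ℝ) - d')
          have b2 := neg_abs_le ((d : ℝ) - d')
          constructor <;> linarith
        linarith
      have hem1 : e / m k ≤ 1 := by rw [div_le_one (by positivity)]; exact hem
      have hpow : (e / m k) * ρ ^ s ≤ |g t - g t'| ^ s := by
        calc (e / m k) * ρ ^ s ≤ (e / m k) ^ s * ρ ^ s := by
              gcongr
              calc e / m k = (e / m k) ^ (1 : ℝ) := by simp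
                _ ≤ (e / m k) ^ s := Real.rpow_le_rpow_of_exponent_ge (by positivity) hem1 hs1
          _ = (e * γ / 2) ^ s := by
              rw [← Real.mul_rpow (by positivity) hρk.le]; congr 1; rw [hγ]; field_simp
          _ ≤ _ := Real.rpow_le_rpow (by positivity) hglow hs.le
      have f1 : |t - t'| ≤ 2 * (e / m k) / Mk := by
        rw [le_div_iff₀ hMk, ← mul_div_assoc, le_div_iff₀ (by positivity)]
        linarith
      have f2 : 2 * (e / m k) / Mk ≤ 2 * C0 * ((e / m k) * ρ ^ s) := by
        rw [div_le_iff₀ hMk]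
        have : 0 ≤ 2 * (e / m k) := by positivity
        nlinarith
      have f3 : 2 * C0 * ((e / m k) * ρ ^ s) ≤ 2 * C0 * |g t - g t'| ^ s := by gcongr
      linarith
  -- conclude
  have hginj : InjOn g (Ico (0:ℝ) 1) := by
    intro t ht t' ht' h
    have := hhold t ht t' ht'
    rw [h, sub_self, abs_zero, Real.zero_rpow hs.ne', mul_zero] at this
    exact sub_eq_zero.1 (abs_nonpos_iff.1 this)
  set f := Function.invFunOn g (Ico (0:ℝ) 1) with hf
  have hfg : ∀ t ∈ Ico (0:ℝ) 1, f (g t) = t := fun t ht => hginj.leftInvOn_invFunOn ht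
  have hH : HolderOnWith (Real.toNNReal (2 * C0)) (Real.toNNReal s) f (g '' Ico (0:ℝ) 1) := by
    rintro _ ⟨t, ht, rfl⟩ _ ⟨t', ht', rfl⟩
    rw [hfg t ht, hfg t' ht', edist_dist, edist_dist, Real.dist_eq, Real.dist_eq, Real.coe_toNNReal s hs.le,
      ENNReal.ofReal_rpow_of_nonneg (abs_nonneg _) hs.le]
    change _ ≤ ENNReal.ofReal (2 * C0) * _
    rw [← ENNReal.ofReal_mul (by positivity)]
    exact ENNReal.ofReal_le_ofReal (hhold t ht t' ht')
  have hd := hH.dimH_image_le (by simpa using hs)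
  have himg : f '' (g '' Ico (0:ℝ) 1) = Ico 0 1 := by
    rw [image_image]
    exact (image_congr hfg).trans (image_id' _)
  rw [himg, Real.dimH_of_nonempty_interior (by rw [interior_Ico]; exact ⟨1/2, by norm_num, by norm_num⟩)] at hd
  have hmono : dimH (g '' Ico (0:ℝ) 1) ≤ dimH {y ∈ Icc u v | ∃ᶠ n in atTop, |x n - y| < (n : ℝ) ^ (-α)} := by
    apply dimH_mono
    rintro _ ⟨t, _, rfl⟩
    exact hmem t
  refine le_trans ?_ hmono
  have hs0 : ENNReal.ofReal s ≠ 0 := by simpa using hs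
  have := (ENNReal.le_div_iff_mul_le (Or.inl hs0) (Or.inl ENNReal.ofReal_ne_top)).1 hd
  simpa using this

structure Branch (f : ℝ → ℝ) (V : Set ℝ) (lam D : ℝ) : Prop where
  isOpen : IsOpen V
  ord : V.OrdConnected
  sub : V ⊆ Ioo 0 1
  maps : MapsTo f V (Icc 0 1)
  mono : StrictMonoOn f V ∨ StrictAntiOn f V
  diff : ∀ x ∈ V, DifferentiableAt ℝ f x
  expd : ∀ x ∈ V, lam ≤ |deriv f x|
  dist : ∀ x ∈ V, ∀ y ∈ V, |deriv f x| ≤ Real.exp (D * |f x - f y|) * |deriv f y|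

namespace Branch

variable {f h : ℝ → ℝ} {V K : Set ℝ} {lam lam' D D' : ℝ}

lemma contOn (H : Branch f V lam D) : ContinuousOn f V :=
  fun x hx => (H.diff x hx).continuousAt.continuousWithinAt

lemma injOn (H : Branch f V lam D) : InjOn f V := by
  rcases H.mono with h | h
  · exact h.injOn
  · exact h.injOn

lemma expand_lt (H : Branch f V lam D) {x y : ℝ} (hx : x ∈ V) (hy : y ∈ V) (hxy : x < y) :
    lam * |x - y| ≤ |f x - f y| := by
  have hsub : Icc x y ⊆ V := H.ord.out hx hy
  obtain ⟨z, hz, hz2⟩ := exists_deriv_eq_slope f hxy (H.contOn.mono hsub)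
    (fun z hz => (H.diff z (hsub (Ioo_subset_Icc_self hz))).differentiableWithinAt)
  have h1 := H.expd z (hsub (Ioo_subset_Icc_self hz))
  rw [hz2, abs_div, le_div_iff₀ (abs_pos.2 (by linarith))] at h1
  rw [abs_sub_comm x y, abs_sub_comm (f x)]
  exact h1

lemma expand (H : Branch f V lam D) {x y : ℝ} (hx : x ∈ V) (hy : y ∈ V) :
    lam * |x - y| ≤ |f x - f y| := by
  rcases lt_trichotomy x y with h | h | h
  · exact H.expand_lt hx hy h
  · subst h; simp
  · rw [abs_sub_comm x y, abs_sub_comm (f x)]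
    exact H.expand_lt hy hx h

lemma comp (H : Branch f V lam D) (H' : Branch h K lam' D') (hlam : 0 < lam) (hlam' : 0 < lam')
    (hD : 0 ≤ D) :
    Branch (h ∘ f) (V ∩ f ⁻¹' K) (lam' * lam) (D' + D / lam') where
  isOpen := H.contOn.isOpen_inter_preimage H.isOpen H'.isOpen
  ord := by
    refine ⟨fun x hx y hy z hz => ?_⟩
    have hzV : z ∈ V := H.ord.out hx.1 hy.1 hz
    refine ⟨hzV, ?_⟩
    rcases H.mono with hm | hm
    · exact H'.ord.out hx.2 hy.2 ⟨hm.monotoneOn hx.1 hzV hz.1, hm.monotoneOn hzV hy.1 hz.2⟩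
    · exact H'.ord.out hy.2 hx.2 ⟨hm.antitoneOn hzV hy.1 hz.2, hm.antitoneOn hx.1 hzV hz.1⟩
  sub := fun x hx => H.sub hx.1
  maps := fun x hx => H'.maps hx.2
  mono := by
    have hmt : MapsTo f (V ∩ f ⁻¹' K) K := fun x hx => hx.2
    rcases H.mono with hm | hm <;> rcases H'.mono with hm' | hm'
    · exact Or.inl (hm'.comp (hm.mono inter_subset_left) hmt)
    · exact Or.inr (hm'.comp_strictMonoOn (hm.mono inter_subset_left) hmt)
    · exact Or.inr (hm'.comp_strictAntiOn (hm.mono inter_subset_left) hmt)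
    · exact Or.inl (hm'.comp (hm.mono inter_subset_left) hmt)
  diff := fun x hx => (H'.diff _ hx.2).comp x (H.diff x hx.1)
  expd := by
    intro x hx
    rw [deriv_comp x (H'.diff _ hx.2) (H.diff x hx.1), abs_mul]
    exact mul_le_mul (H'.expd _ hx.2) (H.expd _ hx.1) hlam.le (abs_nonneg _)
  dist := by
    intro x hx y hy
    rw [deriv_comp x (H'.diff _ hx.2) (H.diff x hx.1), deriv_comp y (H'.diff _ hy.2) (H.diff y hy.1),
      abs_mul, abs_mul]
    have h1 := H'.dist _ hx.2 _ hy.2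
    have h2 := H.dist _ hx.1 _ hy.1
    have h3 := H'.expand hx.2 hy.2
    have h4 : D * |f x - f y| ≤ D / lam' * |h (f x) - h (f y)| := by
      have : |f x - f y| ≤ |h (f x) - h (f y)| / lam' := by
        rw [le_div_iff₀ hlam']; linarith
      calc D * |f x - f y| ≤ D * (|h (f x) - h (f y)| / lam') := by gcongr
        _ = _ := by ring
    calc |deriv h (f x)| * |deriv f x|
        ≤ (Real.exp (D' * |h (f x) - h (f y)|) * |deriv h (f y)|) *
          (Real.exp (D / lam' * |h (f x) - h (f y)|) * |deriv f y|) := by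
          gcongr
          exact h2.trans (by gcongr)
      _ = Real.exp ((D' + D / lam') * |h (f x) - h (f y)|) * (|deriv h (f y)| * |deriv f y|) := by
          rw [add_mul, Real.exp_add]; ring

lemma weaken (H : Branch f V lam D) (hD : D ≤ D') : Branch f V lam D' :=
  { H with
    dist := fun x hx y hy => (H.dist x hx y hy).trans (by gcongr) }

lemma image_eq (H : Branch f V lam D) {A : Set ℝ} (hA : MeasurableSet A) (hAV : A ⊆ V) :
    volume (f '' A) = ∫⁻ x in A, ENNReal.ofReal |deriv f x| := by
  have := lintegral_image_eq_lintegral_abs_deriv_mul hA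
    (fun x hx => (H.diff x (hAV hx)).hasDerivAt.hasDerivWithinAt) (H.injOn.mono hAV) (fun _ => 1)
  simpa using this

lemma fin_im (H : Branch f V lam D) {A : Set ℝ} (hAV : A ⊆ V) : volume (f '' A) ≠ ⊤ := by
  have : f '' A ⊆ Icc 0 1 := by
    rintro _ ⟨x, hx, rfl⟩; exact H.maps (hAV hx)
  exact ne_top_of_le_ne_top (by simp) (measure_mono this)

lemma fin_dom (H : Branch f V lam D) {A : Set ℝ} (hAV : A ⊆ V) : volume A ≠ ⊤ :=
  ne_top_of_le_ne_top (by simp) (measure_mono (hAV.trans H.sub))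

lemma dist' (H : Branch f V lam D) (hD : 0 ≤ D) {x y : ℝ} (hx : x ∈ V) (hy : y ∈ V) :
    |deriv f x| ≤ Real.exp D * |deriv f y| := by
  refine (H.dist x hx y hy).trans ?_
  gcongr
  have h1 := H.maps hx
  have h2 := H.maps hy
  have : |f x - f y| ≤ 1 := by
    rw [abs_le]; constructor <;> linarith [h1.1, h1.2, h2.1, h2.2]
  nlinarith

lemma meas_le (H : Branch f V lam D) (hD : 0 ≤ D) {A : Set ℝ} (hA : MeasurableSet A) (hAV : A ⊆ V)
    {x0 : ℝ} (hx0 : x0 ∈ V) :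
    volume.real (f '' A) ≤ Real.exp D * |deriv f x0| * volume.real A := by
  have h1 : volume (f '' A) ≤ ENNReal.ofReal (Real.exp D * |deriv f x0|) * volume A := by
    rw [H.image_eq hA hAV, ← setLIntegral_const]
    exact setLIntegral_mono' hA fun x hx => ENNReal.ofReal_le_ofReal (H.dist' hD (hAV hx) hx0)
  have := ENNReal.toReal_mono (ENNReal.mul_ne_top ENNReal.ofReal_ne_top (H.fin_dom hAV)) h1
  rwa [ENNReal.toReal_mul, ENNReal.toReal_ofReal (by positivity)] at this

lemma meas_ge (H : Branch f V lam D) (hD : 0 ≤ D) {A : Set ℝ} (hA : MeasurableSet A) (hAV : A ⊆ V)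
    {x0 : ℝ} (hx0 : x0 ∈ V) :
    |deriv f x0| * volume.real A ≤ Real.exp D * volume.real (f '' A) := by
  have h1 : ENNReal.ofReal (Real.exp (-D) * |deriv f x0|) * volume A ≤ volume (f '' A) := by
    rw [H.image_eq hA hAV, ← setLIntegral_const]
    refine setLIntegral_mono' hA fun x hx => ENNReal.ofReal_le_ofReal ?_
    have := H.dist' hD hx0 (hAV hx)
    rw [Real.exp_neg, inv_mul_le_iff₀ (Real.exp_pos _)]
    exact this
  have := ENNReal.toReal_mono (H.fin_im hAV) h1
  rw [ENNReal.toReal_mul, ENNReal.toReal_ofReal (by positivity), Real.exp_neg, mul_assoc,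
    inv_mul_le_iff₀ (Real.exp_pos _)] at this
  exact this

lemma meas_exp (H : Branch f V lam D) (hlam : 0 < lam) {A : Set ℝ} (hA : MeasurableSet A) (hAV : A ⊆ V) :
    lam * volume.real A ≤ volume.real (f '' A) := by
  have h1 : ENNReal.ofReal lam * volume A ≤ volume (f '' A) := by
    rw [H.image_eq hA hAV, ← setLIntegral_const]
    exact setLIntegral_mono' hA fun x hx => ENNReal.ofReal_le_ofReal (H.expd _ (hAV hx))
  have := ENNReal.toReal_mono (H.fin_im hAV) h1
  rwa [ENNReal.toReal_mul, ENNReal.toReal_ofReal hlam.le] at this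

lemma M1 (H : Branch f V lam D) (hD : 0 ≤ D) {A : Set ℝ} (hA : MeasurableSet A) (hAV : A ⊆ V) :
    volume.real A * volume.real (f '' V) ≤ Real.exp D ^ 2 * (volume.real V * volume.real (f '' A)) := by
  rcases V.eq_empty_or_nonempty with hV | ⟨x0, hx0⟩
  · have : A = ∅ := by rw [hV] at hAV; exact subset_empty_iff.1 hAV
    subst this; simp
  have h1 := H.meas_ge hD hA hAV hx0
  have h2 := H.meas_le hD H.isOpen.measurableSet le_rfl hx0
  calc volume.real A * volume.real (f '' V) ≤ volume.real A * (Real.exp D * |deriv f x0| * volume.real V) := by gcongr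
    _ = (Real.exp D * volume.real V) * (|deriv f x0| * volume.real A) := by ring
    _ ≤ (Real.exp D * volume.real V) * (Real.exp D * volume.real (f '' A)) := by gcongr
    _ = _ := by ring

lemma M2 (H : Branch f V lam D) (hD : 0 ≤ D) {A : Set ℝ} (hA : MeasurableSet A) (hAV : A ⊆ V) :
    volume.real (f '' A) * volume.real V ≤ Real.exp D ^ 2 * (volume.real A * volume.real (f '' V)) := by
  rcases V.eq_empty_or_nonempty with hV | ⟨x0, hx0⟩
  · have : A = ∅ := by rw [hV] at hAV; exact subset_empty_iff.1 hAV
    subst this; simp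
  have h1 := H.meas_ge hD H.isOpen.measurableSet le_rfl hx0
  have h2 := H.meas_le hD hA hAV hx0
  calc volume.real (f '' A) * volume.real V ≤ (Real.exp D * |deriv f x0| * volume.real A) * volume.real V := by gcongr
    _ = (Real.exp D * volume.real A) * (|deriv f x0| * volume.real V) := by ring
    _ ≤ (Real.exp D * volume.real A) * (Real.exp D * volume.real (f '' V)) := by gcongr
    _ = _ := by ring

lemma image_ord (H : Branch f V lam D) : (f '' V).OrdConnected :=
  (H.ord.isPreconnected.image f H.contOn).ordConnected

end Branch

def Wd (ι : Type) : ℕ → Type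
  | 0 => Unit
  | n + 1 => Wd ι n × ι

noncomputable instance Wd.fintype (ι : Type) [Fintype ι] : (n : ℕ) → Fintype (Wd ι n)
  | 0 => inferInstanceAs (Fintype Unit)
  | n + 1 => @instFintypeProd (Wd ι n) ι (Wd.fintype ι n) _

def cyl {ι : Type} (T : ℝ → ℝ) (K : ι → Set ℝ) : (n : ℕ) → Wd ι n → Set ℝ
  | 0, _ => Ioo 0 1
  | n + 1, w => cyl T K n w.1 ∩ T^[n] ⁻¹' K w.2

structure PW {ι : Type} (T : ℝ → ℝ) (K : ι → Set ℝ) (lam D : ℝ) : Prop where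
  one_lt : 1 < lam
  D_nonneg : 0 ≤ D
  branch : ∀ i, Branch T (K i) lam D
  disj : Pairwise (Function.onFun Disjoint K)
  cover : (Icc 0 1 \ ⋃ i, K i).Countable

namespace PW

variable {ι : Type} {T : ℝ → ℝ} {K : ι → Set ℝ} {lam D : ℝ}

lemma cylBranch (P : PW T K lam D) (n : ℕ) (w : Wd ι n) :
    Branch (T^[n]) (cyl T K n w) (lam ^ n) (D * lam / (lam - 1)) := by
  have h1 : 0 < lam - 1 := by linarith [P.one_lt]
  have h2 : 0 < lam := by linarith [P.one_lt]
  have h3 := P.D_nonneg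
  induction n with
  | zero =>
    refine ⟨isOpen_Ioo, ordConnected_Ioo, subset_rfl, ?_, Or.inl ?_, ?_, ?_, ?_⟩
    · exact fun x hx => Ioo_subset_Icc_self hx
    · exact strictMono_id.strictMonoOn _
    · exact fun x hx => differentiableAt_id
    · intro x hx; simp
    · intro x hx y hy
      simp only [Function.iterate_zero, deriv_id, abs_one, mul_one]
      exact Real.one_le_exp (by positivity)
  | succ n ih =>
    have := (ih w.1).comp (P.branch w.2) (by positivity) h2 (by positivity)
    rw [← Function.iterate_succ', ← pow_succ'] at this
    have e : D + D * lam / (lam - 1) / lam = D * lam / (lam - 1) := by field_simp; ring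
    rw [e] at this
    exact this

lemma cylDisj (P : PW T K lam D) (n : ℕ) : Pairwise (Function.onFun Disjoint (cyl T K n)) := by
  induction n with
  | zero => intro a b h; exact absurd rfl h
  | succ n ih =>
    rintro ⟨w, i⟩ ⟨w', i'⟩ h
    by_cases hw : w = w'
    · have hi : i ≠ i' := by
        rintro rfl; exact h (by rw [hw])
      exact ((P.disj hi).preimage _).mono inter_subset_right inter_subset_right
    · exact (ih hw).mono inter_subset_left inter_subset_left

lemma cylCover [Fintype ι] (P : PW T K lam D) (n : ℕ) : (Icc 0 1 \ ⋃ w, cyl T K n w).Countable := by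
  induction n with
  | zero =>
    refine (Set.toFinite {(0:ℝ), 1}).countable.mono ?_
    rintro x ⟨hx, hx2⟩
    have hx3 : x ∉ Ioo (0:ℝ) 1 := fun h => hx2 (mem_iUnion.2 ⟨(), h⟩)
    simp only [mem_Icc, mem_Ioo, not_and, not_lt, mem_insert_iff, mem_singleton_iff] at *
    by_cases h0 : x = 0
    · exact Or.inl h0
    · exact Or.inr (le_antisymm hx.2 (hx3 (lt_of_le_of_ne hx.1 (Ne.symm h0))))
  | succ n ih =>
    have h2 : (⋃ w : Wd ι n, (cyl T K n w ∩ T^[n] ⁻¹' (Icc 0 1 \ ⋃ i, K i))).Countable := by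
      refine countable_iUnion fun w => ?_
      refine MapsTo.countable_of_injOn (f := T^[n]) (t := Icc 0 1 \ ⋃ i, K i) (fun x hx => hx.2)
        ((P.cylBranch n w).injOn.mono inter_subset_left) P.cover
    refine (ih.union h2).mono ?_
    rintro x ⟨hx, hx2⟩
    by_cases h : x ∈ ⋃ w, cyl T K n w
    · right
      obtain ⟨w, hw⟩ := mem_iUnion.1 h
      refine mem_iUnion.2 ⟨w, hw, (P.cylBranch n w).maps hw, ?_⟩
      intro hi
      obtain ⟨i, hi⟩ := mem_iUnion.1 hi
      exact hx2 (mem_iUnion.2 ⟨(w, i), hw, hi⟩)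
    · exact Or.inl ⟨hx, h⟩

lemma iter [Fintype ι] (P : PW T K lam D) {p : ℕ} (hp : p ≠ 0) :
    PW (T^[p]) (cyl T K p) (lam ^ p) (D * lam / (lam - 1)) where
  one_lt := one_lt_pow₀ P.one_lt hp
  D_nonneg := by
    have h1 : 0 < lam - 1 := by linarith [P.one_lt]
    have h2 : 0 < lam := by linarith [P.one_lt]
    have h3 := P.D_nonneg
    positivity
  branch := P.cylBranch p
  disj := P.cylDisj p
  cover := P.cylCover p

lemma cyl_expand (P : PW T K lam D) (n l : ℕ) (w : Wd ι (n + l)) {x y : ℝ}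
    (hx : x ∈ cyl T K (n + l) w) (hy : y ∈ cyl T K (n + l) w) :
    lam ^ l * |T^[n] x - T^[n] y| ≤ |T^[n + l] x - T^[n + l] y| := by
  have h2 : 0 < lam := by linarith [P.one_lt]
  induction l with
  | zero => simp
  | succ l ih =>
    have h := ih w.1 hx.1 hy.1
    have h3 := (P.branch w.2).expand hx.2 hy.2
    rw [← add_assoc, Function.iterate_succ_apply', Function.iterate_succ_apply', pow_succ']
    calc lam * lam ^ l * |T^[n] x - T^[n] y| = lam * (lam ^ l * |T^[n] x - T^[n] y|) := by ring
      _ ≤ lam * |T^[n + l] x - T^[n + l] y| := by gcongr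
      _ ≤ _ := h3

lemma cyl_close (P : PW T K lam D) (n l : ℕ) (w : Wd ι (n + l)) {x y : ℝ}
    (hx : x ∈ cyl T K (n + l) w) (hy : y ∈ cyl T K (n + l) w) :
    lam ^ l * |T^[n] x - T^[n] y| ≤ 1 := by
  refine (P.cyl_expand n l w hx hy).trans ?_
  have h1 := (P.cylBranch _ w).maps hx
  have h2 := (P.cylBranch _ w).maps hy
  rw [abs_le]; constructor <;> linarith [h1.1, h1.2, h2.1, h2.2]

end PW

lemma bad_card {ι : Type} [Fintype ι] {K : ι → Set ℝ} (hK : ∀ i, (K i).OrdConnected)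
    (hd : Pairwise (Function.onFun Disjoint K)) {J : Set ℝ} (hJ : J.OrdConnected) (hJ1 : J ⊆ Icc 0 1)
    [DecidablePred fun i => (J ∩ K i).Nonempty ∧ ¬ K i ⊆ J] :
    (Finset.univ.filter (fun i => (J ∩ K i).Nonempty ∧ ¬ K i ⊆ J)).card ≤ 2 := by
  classical
  have hb1 : BddBelow J := ⟨0, fun x hx => (hJ1 hx).1⟩
  have hb2 : BddAbove J := ⟨1, fun x hx => (hJ1 hx).2⟩
  have hone : ∀ z : ℝ, (Finset.univ.filter (fun i => z ∈ K i)).card ≤ 1 := by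
    intro z
    rw [Finset.card_le_one]
    intro i hi j hj
    by_contra hij
    exact disjoint_left.1 (hd hij) (Finset.mem_filter.1 hi).2 (Finset.mem_filter.1 hj).2
  have hsub : Finset.univ.filter (fun i => (J ∩ K i).Nonempty ∧ ¬ K i ⊆ J) ⊆
      Finset.univ.filter (fun i => sInf J ∈ K i) ∪ Finset.univ.filter (fun i => sSup J ∈ K i) := by
    intro i hi
    obtain ⟨⟨z', hz'J, hz'K⟩, hn⟩ := (Finset.mem_filter.1 hi).2
    obtain ⟨z, hzK, hzJ⟩ := not_subset.1 hn
    have hne : J.Nonempty := ⟨z', hz'J⟩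
    rcases lt_trichotomy z z' with h | h | h
    · apply Finset.mem_union_left
      refine Finset.mem_filter.2 ⟨Finset.mem_univ _, (hK i).out hzK hz'K ⟨?_, csInf_le hb1 hz'J⟩⟩
      refine le_csInf hne fun b hb => ?_
      by_contra hlt
      exact hzJ (hJ.out hb hz'J ⟨(not_le.1 hlt).le, h.le⟩)
    · exact absurd (h ▸ hz'J) hzJ
    · apply Finset.mem_union_right
      refine Finset.mem_filter.2 ⟨Finset.mem_univ _, (hK i).out hz'K hzK ⟨le_csSup hb2 hz'J, ?_⟩⟩
      refine csSup_le hne fun b hb => ?_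
      by_contra hlt
      exact hzJ (hJ.out hz'J hb ⟨h.le, (not_le.1 hlt).le⟩)
  calc _ ≤ _ := Finset.card_le_card hsub
    _ ≤ _ := Finset.card_union_le _ _
    _ ≤ 1 + 1 := Nat.add_le_add (hone _) (hone _)

lemma sum_real_le {κ : Type} [Fintype κ] {A : κ → Set ℝ} {B : Set ℝ} (hA : ∀ k, MeasurableSet (A k))
    (hd : Pairwise (Function.onFun Disjoint A)) (hs : ∀ k, A k ⊆ B) (hB : volume B ≠ ⊤) :
    ∑ k, volume.real (A k) ≤ volume.real B := by
  have h1 : volume (⋃ k, A k) = ∑ k, volume (A k) := by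
    rw [measure_iUnion hd hA, tsum_fintype]
  have h2 : ∑ k, volume (A k) ≤ volume B := h1 ▸ measure_mono (iUnion_subset hs)
  have h3 := ENNReal.toReal_mono hB h2
  rwa [ENNReal.toReal_sum (fun k _ => ne_top_of_le_ne_top hB (measure_mono (hs k)))] at h3

namespace PW

variable {ι : Type} {T : ℝ → ℝ} {K : ι → Set ℝ} {lam D : ℝ}

noncomputable def cst (lam D : ℝ) : ℝ := Real.exp (D * lam / (lam - 1)) ^ 2

lemma Dinf_nonneg (P : PW T K lam D) : 0 ≤ D * lam / (lam - 1) := by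
  have h1 : 0 < lam - 1 := by linarith [P.one_lt]
  have h2 : 0 < lam := by linarith [P.one_lt]
  have h3 := P.D_nonneg
  positivity

lemma one_le_cst (P : PW T K lam D) : 1 ≤ cst lam D :=
  one_le_pow₀ (Real.one_le_exp P.Dinf_nonneg)

lemma cyl_image (n : ℕ) (w : Wd ι n) (i : ι) :
    T^[n] '' cyl T K (n + 1) (w, i) = T^[n] '' cyl T K n w ∩ K i :=
  image_inter_preimage _ _ _

lemma cyl_image' (n : ℕ) (w : Wd ι n) (i : ι) :
    T^[n + 1] '' cyl T K (n + 1) (w, i) = T '' (T^[n] '' cyl T K n w ∩ K i) := by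
  rw [Function.iterate_succ', image_comp, cyl_image]

noncomputable def yv (T : ℝ → ℝ) (K : ι → Set ℝ) (n : ℕ) (w : Wd ι n) : ℝ :=
  volume.real (cyl T K n w) / volume.real (T^[n] '' cyl T K n w)

lemma yv_nonneg (n : ℕ) (w : Wd ι n) : 0 ≤ yv T K n w := by unfold yv; positivity

lemma image_sub (P : PW T K lam D) (n : ℕ) (w : Wd ι n) : T^[n] '' cyl T K n w ⊆ Icc 0 1 := by
  rintro _ ⟨x, hx, rfl⟩; exact (P.cylBranch n w).maps hx

open Classical in
lemma yv_step [Fintype ι] (P : PW T K lam D) (hlam : 4 * cst lam D ≤ lam) {δ : ℝ} (hδ : 0 < δ)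
    (hδK : ∀ i, (K i).Nonempty → δ ≤ volume.real (K i)) (n : ℕ) (w : Wd ι n) (i : ι) :
    yv T K (n + 1) (w, i) ≤ volume.real (cyl T K (n + 1) (w, i)) / δ +
      (if ((T^[n] '' cyl T K n w) ∩ K i).Nonempty ∧ ¬ K i ⊆ T^[n] '' cyl T K n w then 1 / 4 * yv T K n w else 0) := by
  have hc := P.one_le_cst
  have hB := P.cylBranch n w
  have hB' := P.cylBranch (n+1) (w, i)
  have hl1 := P.one_lt
  have hl0 : 0 < lam := by linarith
  set J := T^[n] '' cyl T K n w with hJ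
  have himg := cyl_image' (T := T) (K := K) n w i
  have hJm : MeasurableSet (J ∩ K i) := hB.image_ord.measurableSet.inter (P.branch i).isOpen.measurableSet
  have hexp := (P.branch i).meas_exp hl0 hJm inter_subset_right
  rw [← himg] at hexp
  have hVm : MeasurableSet (cyl T K (n + 1) (w, i)) := hB'.isOpen.measurableSet
  have hVs : cyl T K (n + 1) (w, i) ⊆ cyl T K n w := inter_subset_left
  by_cases hne : (J ∩ K i).Nonempty
  swap
  · have h0 : cyl T K (n + 1) (w, i) = ∅ := by
      have := cyl_image (T := T) (K := K) n w i
      rw [← hJ, not_nonempty_iff_eq_empty.1 hne] at this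
      exact image_eq_empty.1 this
    have : yv T K (n + 1) (w, i) = 0 := by
      unfold yv; rw [h0]; simp
    rw [this, if_neg (by tauto)]
    positivity
  by_cases hs : K i ⊆ J
  · rw [if_neg (by tauto), add_zero]
    unfold yv
    have h1 : δ ≤ volume.real (K i) := hδK i (hne.mono inter_subset_right)
    rw [inter_eq_right.2 hs] at hexp
    gcongr
    nlinarith
  · rw [if_pos ⟨hne, hs⟩]
    have h1 := hB.M1 P.Dinf_nonneg hVm hVs
    rw [cyl_image] at h1
    change _ ≤ cst lam D * _ at h1
    rw [← hJ] at h1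
    have h2 : yv T K (n + 1) (w, i) ≤ 1 / 4 * yv T K n w := by
      unfold yv
      rw [← hJ]
      apply div_le_of_le_mul₀ (by positivity) (by positivity)
      rcases eq_or_lt_of_le (measureReal_nonneg (μ := volume) (s := J)) with hJ0 | hJ0
      · have h3 := hB.meas_exp (by positivity) hVm hVs
        have h4 : volume.real (T^[n] '' cyl T K (n + 1) (w, i)) ≤ volume.real J :=
          measureReal_mono (image_mono hVs) (hB.fin_im le_rfl)
        have h5 : 0 < lam ^ n := by positivity
        have h6 : volume.real (cyl T K (n + 1) (w, i)) ≤ 0 := by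
          by_contra hcon
          nlinarith
        exact h6.trans (by positivity)
      · set a := volume.real (cyl T K (n + 1) (w, i))
        set b := volume.real (cyl T K n w)
        set d := volume.real J
        set e := volume.real (J ∩ K i)
        set e' := volume.real (T^[n + 1] '' cyl T K (n + 1) (w, i))
        have hb : 0 ≤ b := measureReal_nonneg
        have he : 0 ≤ e := measureReal_nonneg
        have h7 : 1 / 4 * (b / d) * e' = (b * e' / 4) / d := by ring
        rw [h7, le_div_iff₀ hJ0]
        have h8 : 4 * cst lam D * e ≤ e' := le_trans (by gcongr) hexp
        nlinarith [mul_le_mul_of_nonneg_left h8 hb]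
    have : 0 ≤ volume.real (cyl T K (n + 1) (w, i)) / δ := by positivity
    linarith

lemma exists_delta [Fintype ι] (P : PW T K lam D) :
    ∃ δ > 0, ∀ i, (K i).Nonempty → δ ≤ volume.real (K i) := by
  classical
  have hpos : ∀ i, (K i).Nonempty → 0 < volume.real (K i) := fun i hi =>
    ENNReal.toReal_pos ((P.branch i).isOpen.measure_pos volume hi).ne' ((P.branch i).fin_dom le_rfl)
  by_cases h : (Finset.univ.filter fun i => (K i).Nonempty).Nonempty
  · refine ⟨(Finset.univ.filter fun i => (K i).Nonempty).inf' h fun i => volume.real (K i), ?_, ?_⟩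
    · rw [gt_iff_lt, Finset.lt_inf'_iff]
      exact fun i hi => hpos i (Finset.mem_filter.1 hi).2
    · exact fun i hi => Finset.inf'_le (f := fun i => volume.real (K i)) (b := i) (Finset.mem_filter.2 ⟨Finset.mem_univ _, hi⟩)
  · exact ⟨1, one_pos, fun i hi => absurd ⟨i, Finset.mem_filter.2 ⟨Finset.mem_univ _, hi⟩⟩ h⟩

lemma cyl_meas (P : PW T K lam D) (n : ℕ) (w : Wd ι n) : MeasurableSet (cyl T K n w) :=
  (P.cylBranch n w).isOpen.measurableSet

lemma Y_bound [Fintype ι] (P : PW T K lam D) (hlam : 4 * cst lam D ≤ lam) :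
    ∃ C > 0, ∀ n, ∑ w : Wd ι n, yv T K n w ≤ C := by
  classical
  obtain ⟨δ, hδ, hδK⟩ := P.exists_delta
  refine ⟨1 + 2 / δ, by positivity, fun n => ?_⟩
  induction n with
  | zero =>
    have : ∑ w : Wd ι 0, yv T K 0 w = yv T K 0 () :=
      Fintype.sum_unique (ι := Unit) _
    rw [this]
    have h0 : cyl T K 0 () = Ioo 0 1 := rfl
    unfold yv
    rw [h0]
    simp
    positivity
  | succ n ih =>
    have e1 : ∑ w : Wd ι (n + 1), yv T K (n + 1) w = ∑ w : Wd ι n, ∑ i : ι, yv T K (n + 1) (w, i) :=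
      Fintype.sum_prod_type (f := fun w : Wd ι n × ι => yv T K (n + 1) w)
    have e2 : ∀ w : Wd ι n, ∑ i : ι, yv T K (n + 1) (w, i) ≤ volume.real (cyl T K n w) / δ + 1 / 2 * yv T K n w := by
      intro w
      refine (Finset.sum_le_sum fun i _ => P.yv_step hlam hδ hδK n w i).trans ?_
      rw [Finset.sum_add_distrib]
      gcongr
      · rw [← Finset.sum_div]
        gcongr
        refine sum_real_le (fun i => P.cyl_meas (n + 1) (w, i)) ?_ (fun i => inter_subset_left)
          ((P.cylBranch n w).fin_dom le_rfl)
        intro i j hij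
        exact P.cylDisj (n + 1) (fun h => hij (Prod.mk.inj h).2)
      · rw [← Finset.sum_filter, Finset.sum_const, nsmul_eq_mul]
        have := bad_card (fun i => (P.branch i).ord) P.disj (P.cylBranch n w).image_ord (P.image_sub n w)
        have h2 : ((Finset.univ.filter fun i => ((T^[n] '' cyl T K n w) ∩ K i).Nonempty ∧ ¬ K i ⊆ T^[n] '' cyl T K n w).card : ℝ) ≤ 2 := by
          exact_mod_cast this
        have h3 := yv_nonneg (T := T) (K := K) n w
        nlinarith
    rw [e1]
    refine (Finset.sum_le_sum fun w _ => e2 w).trans ?_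
    rw [Finset.sum_add_distrib, ← Finset.sum_div, ← Finset.mul_sum]
    have h4 : ∑ w : Wd ι n, volume.real (cyl T K n w) ≤ 1 := by
      have := sum_real_le (fun w => P.cyl_meas n w) (P.cylDisj n) (fun w => (P.cylBranch n w).sub)
        (B := Ioo 0 1) (by simp)
      simpa using this
    have h5 : (∑ w : Wd ι n, volume.real (cyl T K n w)) / δ ≤ 1 / δ := by gcongr
    have h6 : 2 / δ = 2 * (1 / δ) := by ring
    rw [h6] at ih ⊢
    linarith

lemma short_bound [Fintype ι] (P : PW T K lam D) {C η : ℝ}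
    (hY : ∀ n, ∑ w : Wd ι n, yv T K n w ≤ C) (hη : 0 < η) (n : ℕ) :
    volume {x | ∃ w : Wd ι n, x ∈ cyl T K n w ∧ volume.real (T^[n] '' cyl T K n w) < η} ≤ ENNReal.ofReal (C * η) := by
  classical
  have h1 : {x | ∃ w : Wd ι n, x ∈ cyl T K n w ∧ volume.real (T^[n] '' cyl T K n w) < η} ⊆
      ⋃ w ∈ (Finset.univ.filter fun w : Wd ι n => volume.real (T^[n] '' cyl T K n w) < η), cyl T K n w := by
    rintro x ⟨w, hw, hw2⟩
    exact mem_biUnion (Finset.mem_filter.2 ⟨Finset.mem_univ _, hw2⟩) hw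
  refine (measure_mono h1).trans ((measure_biUnion_finset_le _ _).trans ?_)
  have h2 : ∀ w : Wd ι n, volume (cyl T K n w) = ENNReal.ofReal (volume.real (cyl T K n w)) := fun w =>
    (ENNReal.ofReal_toReal ((P.cylBranch n w).fin_dom le_rfl)).symm
  simp_rw [h2]
  rw [← ENNReal.ofReal_sum_of_nonneg (fun _ _ => measureReal_nonneg)]
  apply ENNReal.ofReal_le_ofReal
  calc _ ≤ ∑ w ∈ (Finset.univ.filter fun w : Wd ι n => volume.real (T^[n] '' cyl T K n w) < η), η * yv T K n w := by
        refine Finset.sum_le_sum fun w hw => ?_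
        have hw2 := (Finset.mem_filter.1 hw).2
        have h3 := (P.cylBranch n w).meas_exp (by have := P.one_lt; positivity) (P.cyl_meas n w) le_rfl
        have hl : 0 < lam ^ n := by have := P.one_lt; positivity
        unfold yv
        rcases eq_or_lt_of_le (measureReal_nonneg (μ := volume) (s := T^[n] '' cyl T K n w)) with h0 | h0
        · rw [← h0] at h3 ⊢
          by_contra hcon
          simp only [div_zero, mul_zero, not_le] at hcon
          nlinarith
        · rw [← mul_div_assoc, le_div_iff₀ h0]
          rw [mul_comm]
          gcongr
    _ ≤ ∑ w, η * yv T K n w := Finset.sum_le_sum_of_subset_of_nonneg (Finset.subset_univ _)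
        (fun w _ _ => mul_nonneg hη.le (yv_nonneg n w))
    _ = η * ∑ w, yv T K n w := by rw [Finset.mul_sum]
    _ ≤ C * η := by rw [mul_comm]; exact mul_le_mul_of_nonneg_right (hY n) hη.le

end PW

namespace PW

variable {ι : Type} {T : ℝ → ℝ} {K : ι → Set ℝ} {lam D : ℝ}

def GG (T : ℝ → ℝ) (K : ι → Set ℝ) (n : ℕ) (J : Set ℝ) : Set ℝ :=
  {x | ∃ w : Wd ι n, x ∈ cyl T K n w ∧ J ⊆ T^[n] '' cyl T K n w}

def Miss (T : ℝ → ℝ) (K : ι → Set ℝ) (n l : ℕ) (B : Set ℝ) : Set ℝ :=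
  {x | ∃ w : Wd ι (n + l), x ∈ cyl T K (n + l) w ∧ ∀ y ∈ cyl T K (n + l) w, T^[n] y ∉ B}

lemma cyl_uniq (P : PW T K lam D) {n : ℕ} {w w' : Wd ι n} {x : ℝ} (h : x ∈ cyl T K n w)
    (h' : x ∈ cyl T K n w') : w = w' := by
  by_contra hne
  exact disjoint_left.1 (P.cylDisj n hne) h h'

lemma cyl_sub (n l : ℕ) (w : Wd ι (n + l)) : ∃ w' : Wd ι n, cyl T K (n + l) w ⊆ cyl T K n w' := by
  induction l with
  | zero => exact ⟨w, le_rfl⟩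
  | succ l ih =>
    obtain ⟨w', hw'⟩ := ih w.1
    exact ⟨w', fun x hx => hw' hx.1⟩

lemma GG_meas (P : PW T K lam D) (n : ℕ) (J : Set ℝ) : MeasurableSet (GG T K n J) := by
  have : GG T K n J = ⋃ w : {w : Wd ι n // J ⊆ T^[n] '' cyl T K n w}, cyl T K n w.1 := by
    ext x; simp [GG, and_comm]
  rw [this]
  exact (isOpen_iUnion fun w : {w : Wd ι n // J ⊆ T^[n] '' cyl T K n w} => (P.cylBranch n w.1).isOpen).measurableSet

lemma Miss_meas (P : PW T K lam D) (n l : ℕ) (B : Set ℝ) : MeasurableSet (Miss T K n l B) := by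
  have : Miss T K n l B = ⋃ w : {w : Wd ι (n + l) // ∀ y ∈ cyl T K (n + l) w, T^[n] y ∉ B}, cyl T K (n + l) w.1 := by
    ext x; simp [Miss, and_comm]
  rw [this]
  exact (isOpen_iUnion fun w : {w : Wd ι (n + l) // ∀ y ∈ cyl T K (n + l) w, T^[n] y ∉ B} => (P.cylBranch (n + l) w.1).isOpen).measurableSet

def CylConst {β : Type} (T : ℝ → ℝ) (K : ι → Set ℝ) (n : ℕ) (ψ : ℝ → β) : Prop :=
  ∀ w : Wd ι n, ∀ x ∈ cyl T K n w, ∀ y ∈ cyl T K n w, ψ x = ψ y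

lemma CylConst.up {β : Type} {n m : ℕ} {ψ : ℝ → β} (h : CylConst T K n ψ) (hnm : n ≤ m) : CylConst T K m ψ := by
  obtain ⟨l, rfl⟩ := Nat.exists_eq_add_of_le hnm
  intro w x hx y hy
  obtain ⟨w', hw'⟩ := cyl_sub (T := T) (K := K) n l w
  exact h w' x (hw' hx) y (hw' hy)

open Classical in
noncomputable def phi (T : ℝ → ℝ) (K : ι → Set ℝ) (n l : ℕ) (J B : Set ℝ) (e : ENNReal) (x : ℝ) : ENNReal :=
  if x ∈ GG T K n J then (if x ∈ Miss T K n l B then e else 0) else 1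

lemma phi_meas (P : PW T K lam D) (n l : ℕ) (J B : Set ℝ) (e : ENNReal) :
    Measurable (phi T K n l J B e) := by
  classical
  exact Measurable.ite (P.GG_meas n J) (Measurable.ite (P.Miss_meas n l B) measurable_const measurable_const) measurable_const

lemma GG_const (P : PW T K lam D) (n : ℕ) (J : Set ℝ) : CylConst T K n (fun x => x ∈ GG T K n J) := by
  intro w x hx y hy
  apply propext
  constructor
  · rintro ⟨w', h1, h2⟩
    obtain rfl := P.cyl_uniq hx h1
    exact ⟨w, hy, h2⟩
  · rintro ⟨w', h1, h2⟩
    obtain rfl := P.cyl_uniq hy h1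
    exact ⟨w, hx, h2⟩

lemma Miss_const (P : PW T K lam D) (n l : ℕ) (B : Set ℝ) :
    CylConst T K (n + l) (fun x => x ∈ Miss T K n l B) := by
  intro w x hx y hy
  apply propext
  constructor
  · rintro ⟨w', h1, h2⟩
    obtain rfl := P.cyl_uniq hx h1
    exact ⟨w, hy, h2⟩
  · rintro ⟨w', h1, h2⟩
    obtain rfl := P.cyl_uniq hy h1
    exact ⟨w, hx, h2⟩

lemma phi_const (P : PW T K lam D) (n l : ℕ) (J B : Set ℝ) (e : ENNReal) :
    CylConst T K (n + l) (phi T K n l J B e) := by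
  intro w x hx y hy
  have h1 : (x ∈ GG T K n J) = (y ∈ GG T K n J) := (P.GG_const n J).up (Nat.le_add_right n l) w x hx y hy
  have h2 : (x ∈ Miss T K n l B) = (y ∈ Miss T K n l B) := P.Miss_const n l B w x hx y hy
  by_cases g1 : y ∈ GG T K n J <;> by_cases g2 : y ∈ Miss T K n l B <;> simp [phi, h1, h2, g1, g2]

lemma lint_split [Fintype ι] (P : PW T K lam D) (n : ℕ) (f : ℝ → ENNReal) :
    ∫⁻ x in Icc 0 1, f x = ∑ w : Wd ι n, ∫⁻ x in cyl T K n w, f x := by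
  have h1 : (Icc (0:ℝ) 1) =ᵐ[volume] ⋃ w : Wd ι n, cyl T K n w := by
    have hs : (⋃ w : Wd ι n, cyl T K n w) ⊆ Icc 0 1 :=
      iUnion_subset fun w => (P.cylBranch n w).sub.trans Ioo_subset_Icc_self
    apply Filter.EventuallyLE.antisymm
    · exact ae_le_set.2 ((P.cylCover n).measure_zero _)
    · exact hs.eventuallyLE
  rw [setLIntegral_congr h1, lintegral_iUnion (fun w => P.cyl_meas n w) (P.cylDisj n), tsum_fintype]

lemma phi_step (P : PW T K lam D) (n l : ℕ) {J B : Set ℝ} (hB : MeasurableSet B) (hBJ : B ⊆ J) (w : Wd ι n) :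
    ∫⁻ x in cyl T K n w, phi T K n l J B (ENNReal.ofReal (Real.exp (volume.real B / cst lam D))) x
      ≤ volume (cyl T K n w) := by
  classical
  set V := cyl T K n w with hV
  have hBr := P.cylBranch n w
  have hc := P.one_le_cst
  by_cases hJ : J ⊆ T^[n] '' V
  · have hG : ∀ x ∈ V, x ∈ GG T K n J := fun x hx => ⟨w, hx, hJ⟩
    have hVm := P.cyl_meas n w
    set e := Real.exp (volume.real B / cst lam D)
    have h1 : ∫⁻ x in V, phi T K n l J B (ENNReal.ofReal e) x
        = ∫⁻ x in V, (Miss T K n l B).indicator (fun _ => ENNReal.ofReal e) x := by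
      refine setLIntegral_congr_fun hVm fun x hx => ?_
      simp only [phi, hG x hx, if_true, indicator]
    rw [h1, lintegral_indicator (P.Miss_meas n l B), Measure.restrict_restrict (P.Miss_meas n l B),
      setLIntegral_const]
    set A := V ∩ T^[n] ⁻¹' B with hA
    have hAm : MeasurableSet A := by
      have := hBr.contOn.measurable_piecewise (g := fun _ => 0) continuousOn_const hVm
      have h2 : A = V ∩ (V.piecewise (T^[n]) (fun _ => 0)) ⁻¹' B := by
        ext x
        simp only [hA, mem_inter_iff, mem_preimage]
        refine and_congr_right fun hx => ?_
        rw [piecewise_eq_of_mem _ _ _ hx]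
      rw [h2]
      exact hVm.inter (this hB)
    have hAim : T^[n] '' A = B := by
      rw [hA, image_inter_preimage, inter_eq_right]
      exact hBJ.trans hJ
    have hsub : Miss T K n l B ∩ V ⊆ V \ A := by
      rintro x ⟨⟨w', h1, h2⟩, hx⟩
      exact ⟨hx, fun hxA => h2 x h1 hxA.2⟩
    have hm2 := hBr.M2 P.Dinf_nonneg hAm inter_subset_left
    rw [hAim] at hm2
    change _ ≤ cst lam D * _ at hm2
    have him : volume.real (T^[n] '' V) ≤ 1 := by
      have := measureReal_mono (μ := volume) (P.image_sub n w) (by simp)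
      simpa using this
    have hv : volume.real (V \ A) = volume.real V - volume.real A :=
      measureReal_sdiff inter_subset_left hAm (hBr.fin_dom le_rfl)
    have key : e * volume.real (Miss T K n l B ∩ V) ≤ volume.real V := by
      have h3 : volume.real (Miss T K n l B ∩ V) ≤ volume.real V - volume.real A := by
        rw [← hv]; exact measureReal_mono hsub (hBr.fin_dom sdiff_subset)
      have h4 : volume.real B / cst lam D * volume.real V ≤ volume.real A := by
        rw [div_mul_eq_mul_div, div_le_iff₀ (by positivity)]
        have : volume.real A * volume.real (T^[n] '' V) ≤ volume.real A * 1 := by gcongr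
        nlinarith
      have h5 : e * (1 - volume.real B / cst lam D) ≤ 1 := by
        have h6 := Real.add_one_le_exp (-(volume.real B / cst lam D))
        calc e * (1 - volume.real B / cst lam D) ≤ e * Real.exp (-(volume.real B / cst lam D)) := by
              gcongr; linarith
          _ = 1 := by rw [← Real.exp_add]; simp
      have he : 0 < e := Real.exp_pos _
      have hV0 : 0 ≤ volume.real V := measureReal_nonneg
      calc e * volume.real (Miss T K n l B ∩ V) ≤ e * ((1 - volume.real B / cst lam D) * volume.real V) := by
            gcongr; linarith
        _ = e * (1 - volume.real B / cst lam D) * volume.real V := by ring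
        _ ≤ 1 * volume.real V := by gcongr
        _ = _ := one_mul _
    have hf1 : volume (Miss T K n l B ∩ V) ≠ ⊤ := hBr.fin_dom inter_subset_right
    have hf2 : volume V ≠ ⊤ := hBr.fin_dom le_rfl
    rw [← ENNReal.ofReal_toReal hf1, ← ENNReal.ofReal_toReal hf2, ← ENNReal.ofReal_mul (Real.exp_pos _).le]
    exact ENNReal.ofReal_le_ofReal key
  · have h1 : ∀ x ∈ V, phi T K n l J B (ENNReal.ofReal (Real.exp (volume.real B / cst lam D))) x = 1 := by
      intro x hx
      unfold phi
      rw [if_neg]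
      rintro ⟨w', h1, h2⟩
      obtain rfl := P.cyl_uniq hx h1
      exact hJ h2
    rw [setLIntegral_congr_fun (P.cyl_meas n w) h1]
    simp [hV]

lemma super_step [Fintype ι] (P : PW T K lam D) (n l : ℕ) {J B : Set ℝ} (hB : MeasurableSet B) (hBJ : B ⊆ J)
    {ψ : ℝ → ENNReal} (hψ : CylConst T K n ψ) :
    ∫⁻ x in Icc 0 1, ψ x * phi T K n l J B (ENNReal.ofReal (Real.exp (volume.real B / cst lam D))) x
      ≤ ∫⁻ x in Icc 0 1, ψ x := by
  rw [P.lint_split n, P.lint_split n]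
  refine Finset.sum_le_sum fun w _ => ?_
  rcases (cyl T K n w).eq_empty_or_nonempty with h0 | ⟨x0, hx0⟩
  · rw [h0]; simp
  have h1 : ∀ x ∈ cyl T K n w, ψ x = ψ x0 := fun x hx => hψ w x hx x0 hx0
  rw [setLIntegral_congr_fun (P.cyl_meas n w) h1, setLIntegral_const,
    setLIntegral_congr_fun (P.cyl_meas n w) (g := fun x => ψ x0 * phi T K n l J B (ENNReal.ofReal (Real.exp (volume.real B / cst lam D))) x)
    (fun x hx => by simp only [h1 x hx]),
    lintegral_const_mul _ (P.phi_meas _ _ _ _ _)]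
  gcongr
  exact P.phi_step n l hB hBJ w

open Classical in
lemma super_bound [Fintype ι] (P : PW T K lam D) (n : ℕ → ℕ) (l : ℕ) (hn : ∀ i, n i + l ≤ n (i + 1))
    {J B : Set ℝ} (hB : MeasurableSet B) (hBJ : B ⊆ J) (M L : ℕ) :
    volume {x ∈ Icc (0:ℝ) 1 | L ≤ ((Finset.range M).filter fun i => x ∈ GG T K (n i) J).card ∧
      ∀ i < M, x ∈ GG T K (n i) J → x ∈ Miss T K (n i) l B} ≤
      ENNReal.ofReal (Real.exp (-(volume.real B / cst lam D * L))) := by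
  set b := volume.real B / cst lam D with hb
  have hb0 : 0 ≤ b := by have := P.one_le_cst; positivity
  set e := ENNReal.ofReal (Real.exp b) with he
  set Φ : ℕ → ℝ → ENNReal := fun M x => ∏ i ∈ Finset.range M, phi T K (n i) l J B e x with hΦ
  have hΦs : ∀ M x, Φ (M + 1) x = Φ M x * phi T K (n M) l J B e x := fun M x => Finset.prod_range_succ _ _
  have hc : ∀ M, CylConst T K (n M) (Φ M) := by
    intro M
    induction M with
    | zero => intro w x _ y _; simp [hΦ]
    | succ M ih =>
      intro w x hx y hy
      rw [hΦs, hΦs, ih.up ((Nat.le_add_right _ l).trans (hn M)) w x hx y hy,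
        (P.phi_const (n M) l J B e).up (hn M) w x hx y hy]
  have hI : ∀ M, ∫⁻ x in Icc 0 1, Φ M x ≤ 1 := by
    intro M
    induction M with
    | zero => simp [hΦ]
    | succ M ih =>
      simp_rw [hΦs]
      exact (P.super_step (n M) l hB hBJ (hc M)).trans ih
  have hm : Measurable (Φ M) := Finset.measurable_fun_prod _ fun i _ => P.phi_meas _ _ _ _ _
  have hM := mul_meas_ge_le_lintegral₀ (μ := volume.restrict (Icc (0:ℝ) 1)) hm.aemeasurable (ENNReal.ofReal (Real.exp (b * L)))
  have hset : {x ∈ Icc (0:ℝ) 1 | L ≤ ((Finset.range M).filter fun i => x ∈ GG T K (n i) J).card ∧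
      ∀ i < M, x ∈ GG T K (n i) J → x ∈ Miss T K (n i) l B} ⊆
      {x | ENNReal.ofReal (Real.exp (b * L)) ≤ Φ M x} ∩ Icc 0 1 := by
    rintro x ⟨hx, h1, h2⟩
    refine ⟨?_, hx⟩
    have h3 : Φ M x = e ^ ((Finset.range M).filter fun i => x ∈ GG T K (n i) J).card := by
      rw [← Finset.prod_const, Finset.prod_filter]
      refine Finset.prod_congr rfl fun i hi => ?_
      unfold phi
      by_cases hg : x ∈ GG T K (n i) J
      · simp [hg, h2 i (Finset.mem_range.1 hi) hg]
      · simp [hg]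
    change _ ≤ Φ M x
    rw [h3, he, ← ENNReal.ofReal_pow (Real.exp_pos _).le, ← Real.exp_nat_mul]
    apply ENNReal.ofReal_le_ofReal
    apply Real.exp_le_exp.2
    have : (L : ℝ) ≤ ((Finset.range M).filter fun i => x ∈ GG T K (n i) J).card := by exact_mod_cast h1
    nlinarith
  have h4 := measure_mono (μ := volume) hset
  rw [Measure.restrict_apply (measurableSet_le measurable_const hm)] at hM
  have h5 := hM.trans (hI M)
  refine h4.trans ?_
  have h6 : ENNReal.ofReal (Real.exp (-(b * L))) * ENNReal.ofReal (Real.exp (b * L)) = 1 := by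
    rw [← ENNReal.ofReal_mul (Real.exp_pos _).le, ← Real.exp_add]; simp
  calc _ = ENNReal.ofReal (Real.exp (-(b * L))) * (ENNReal.ofReal (Real.exp (b * L)) * volume ({x | ENNReal.ofReal (Real.exp (b * L)) ≤ Φ M x} ∩ Icc 0 1)) := by
        rw [← mul_assoc, h6, one_mul]
    _ ≤ ENNReal.ofReal (Real.exp (-(b * L))) * 1 := by gcongr
    _ = _ := mul_one _

end PW

lemma grid_in {I : Set ℝ} (hI : I.OrdConnected) (hI1 : I ⊆ Icc 0 1) {q : ℕ} (hq : 0 < q)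
    (hv : 3 / (q:ℝ) ≤ volume.real I) : ∃ j < q, Icc ((j:ℝ) / q) ((j + 1) / q) ⊆ I := by
  have hq' : (0:ℝ) < q := by exact_mod_cast hq
  have hne : I.Nonempty := by
    rw [nonempty_iff_ne_empty]; rintro rfl
    simp at hv
    have : 0 < 3 / (q:ℝ) := by positivity
    linarith
  have hb1 : BddBelow I := ⟨0, fun x hx => (hI1 hx).1⟩
  have hb2 : BddAbove I := ⟨1, fun x hx => (hI1 hx).2⟩
  set s := sInf I
  set t := sSup I
  have hs0 : 0 ≤ s := le_csInf hne fun x hx => (hI1 hx).1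
  have ht1 : t ≤ 1 := csSup_le hne fun x hx => (hI1 hx).2
  have hst : s ≤ t := csInf_le_csSup hne hb1 hb2
  have hvol : volume.real I ≤ t - s := by
    have h : I ⊆ Icc s t := fun x hx => ⟨csInf_le hb1 hx, le_csSup hb2 hx⟩
    have := measureReal_mono (μ := volume) h (by simp)
    rwa [Real.volume_real_Icc_of_le hst] at this
  have hin : Ioo s t ⊆ I := by
    rintro z ⟨h1, h2⟩
    obtain ⟨a, ha, haz⟩ := exists_lt_of_csInf_lt hne h1
    obtain ⟨b, hb, hbz⟩ := exists_lt_of_lt_csSup hne h2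
    exact hI.out ha hb ⟨haz.le, hbz.le⟩
  have hf1 := Nat.floor_le (show 0 ≤ s * q by positivity)
  have hf2 := Nat.lt_floor_add_one (s * q)
  set f := ⌊s * q⌋₊
  have h3 : 3 ≤ (t - s) * q := by
    have := hv.trans hvol
    rwa [div_le_iff₀ hq'] at this
  have hj1 : s < ((f + 1 : ℕ) : ℝ) / q := by rw [lt_div_iff₀ hq']; push_cast; linarith
  have hj2 : (((f + 1 : ℕ) : ℝ) + 1) / q < t := by rw [div_lt_iff₀ hq']; push_cast; linarith
  refine ⟨f + 1, ?_, fun z hz => hin ⟨hj1.trans_le hz.1, hz.2.trans_lt hj2⟩⟩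
  have : (((f + 1 : ℕ) : ℝ) + 1) / q < 1 := hj2.trans_le ht1
  rw [div_lt_one hq'] at this
  exact_mod_cast (by linarith : ((f + 1 : ℕ) : ℝ) < q)

open Classical in
lemma count_markov (A : ℕ → Set ℝ) (hA : ∀ i, MeasurableSet (A i)) (δ : ENNReal) (hδ : ∀ i, volume (A i) ≤ δ)
    (M : ℕ) (hM : 0 < M) :
    volume {x | M ≤ 2 * ((Finset.range M).filter fun i => x ∈ A i).card} ≤ 2 * δ := by
  set F : ℝ → ENNReal := fun x => ∑ i ∈ Finset.range M, (A i).indicator (fun _ => 1) x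
  have hF : ∀ x, F x = ((Finset.range M).filter fun i => x ∈ A i).card := by
    intro x
    simp only [F, indicator, Finset.sum_ite, Finset.sum_const_zero, add_zero, Finset.sum_const, nsmul_eq_mul, mul_one]
  have hm : Measurable F := Finset.measurable_fun_sum _ fun i _ => measurable_const.indicator (hA i)
  have hI : ∫⁻ x, F x ≤ M * δ := by
    rw [lintegral_finsetSum _ fun i _ => measurable_const.indicator (hA i)]
    calc _ ≤ ∑ i ∈ Finset.range M, δ := by
          refine Finset.sum_le_sum fun i _ => ?_
          rw [lintegral_indicator (hA i)]; simpa using hδ i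
      _ = _ := by simp
  have h1 := mul_meas_ge_le_lintegral₀ (μ := volume) (f := fun x => 2 * F x) (hm.const_mul 2).aemeasurable (M : ENNReal)
  rw [lintegral_const_mul _ hm] at h1
  have h2 : {x | M ≤ 2 * ((Finset.range M).filter fun i => x ∈ A i).card} = {x | (M:ENNReal) ≤ 2 * F x} := by
    ext x
    change _ ↔ (M:ENNReal) ≤ 2 * F x
    rw [hF]
    change M ≤ _ ↔ _
    exact_mod_cast Iff.rfl
  rw [h2]
  have h3 : (M:ENNReal) * volume {x | (M:ENNReal) ≤ 2 * F x} ≤ M * (2 * δ) := by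
    refine h1.trans ?_
    calc _ ≤ 2 * (M * δ) := by gcongr
      _ = _ := by ring
  exact (ENNReal.mul_le_mul_iff_right (by exact_mod_cast hM.ne') (by simp)).1 h3

def Good (S : ℝ → ℝ) (q k : ℕ) (x : ℝ) : Prop :=
  ∃ j < q, ∀ y ∈ Icc ((j:ℝ) / q) ((j + 1 / 2) / q), ∃ n, k ≤ n ∧ n ≤ 4 * q * k ^ 3 * 2 ^ k ∧
    |S^[n] x - y| ≤ 2 * (1 / 2 : ℝ) ^ k

namespace PW

variable {ι : Type} {T : ℝ → ℝ} {K : ι → Set ℝ} {lam D : ℝ}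

lemma level [Fintype ι] (P : PW T K lam D) (hlam : 2 ≤ lam) {C : ℝ}
    (hY : ∀ n, ∑ w : Wd ι n, yv T K n w ≤ C) {q k : ℕ} (hq : 0 < q) (hk : 0 < k) :
    volume {x ∈ Icc (0:ℝ) 1 | ¬ Good T q k x} ≤ 2 * ENNReal.ofReal (C * (3 / q)) +
      q * (2 ^ k * ENNReal.ofReal (Real.exp (-(k ^ 2 / (q * cst lam D))))) := by
  classical
  have hq' : (0:ℝ) < q := by exact_mod_cast hq
  have hc := P.one_le_cst
  set L := k ^ 2 * 2 ^ k with hL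
  have hL0 : 0 < L := by positivity
  set M := 2 * q * L with hM
  have hM0 : 0 < M := by positivity
  set n : ℕ → ℕ := fun i => (M + i) * k with hn
  set J : ℕ → Set ℝ := fun j => Icc ((j:ℝ) / q) ((j + 1) / q) with hJ
  set B : ℕ → ℕ → Set ℝ := fun j r => Icc ((j + r / 2 ^ k) / q) ((j + (r + 1) / 2 ^ k) / q) with hB
  have hBJ : ∀ j r, r < 2 ^ k → B j r ⊆ J j := by
    intro j r hr
    have h1 : ((r:ℝ) + 1) / 2 ^ k ≤ 1 := by
      rw [div_le_one (by positivity)]; exact_mod_cast hr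
    apply Icc_subset_Icc
    · gcongr; linarith [show (0:ℝ) ≤ r / 2 ^ k by positivity]
    · gcongr
  have hBv : ∀ j r, volume.real (B j r) = 1 / (q * 2 ^ k) := by
    intro j r
    rw [hB]
    simp only
    rw [Real.volume_real_Icc_of_le]
    · field_simp; ring
    · gcongr; linarith
  set Sh : ℕ → Set ℝ := fun i => {x | ∃ w : Wd ι (n i), x ∈ cyl T K (n i) w ∧ volume.real (T^[n i] '' cyl T K (n i) w) < 3 / q} with hSh
  have hShm : ∀ i, MeasurableSet (Sh i) := by
    intro i
    have : Sh i = ⋃ w : {w : Wd ι (n i) // volume.real (T^[n i] '' cyl T K (n i) w) < 3 / q}, cyl T K (n i) w.1 := by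
      ext x; simp [hSh, and_comm]
    rw [this]
    exact MeasurableSet.iUnion fun w => P.cyl_meas _ w.1
  have hShv : ∀ i, volume (Sh i) ≤ ENNReal.ofReal (C * (3 / q)) := fun i => P.short_bound hY (by positivity) (n i)
  set E1 := {x | M ≤ 2 * ((Finset.range M).filter fun i => x ∈ Sh i).card} with hE1
  set E2 : ℕ → ℕ → Set ℝ := fun j r => {x ∈ Icc (0:ℝ) 1 | L ≤ ((Finset.range M).filter fun i => x ∈ GG T K (n i) (J j)).card ∧
      ∀ i < M, x ∈ GG T K (n i) (J j) → x ∈ Miss T K (n i) k (B j r)} with hE2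
  set E0 : Set ℝ := ⋃ n : ℕ, Icc 0 1 \ ⋃ w, cyl T K n w with hE0
  have hE0v : volume E0 = 0 := (countable_iUnion fun n => P.cylCover n).measure_zero _
  have hE2v : ∀ j r, r < 2 ^ k → volume (E2 j r) ≤ ENNReal.ofReal (Real.exp (-(k ^ 2 / (q * cst lam D)))) := by
    intro j r hr
    refine (P.super_bound n k (fun i => ?_) measurableSet_Icc (hBJ j r hr) M L).trans (le_of_eq ?_)
    · simp only [hn]; apply le_of_eq; ring
    · rw [hBv, hL]; congr 3; push_cast; field_simp
  have hsub : {x ∈ Icc (0:ℝ) 1 | ¬ Good T q k x} ⊆ E0 ∪ (E1 ∪ ⋃ j ∈ Finset.range q, ⋃ r ∈ Finset.range (2 ^ k), E2 j r) := by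
    rintro x ⟨hx, hG⟩
    by_contra hcon
    apply hG
    simp only [mem_union, not_or] at hcon
    obtain ⟨h0, h1, h2⟩ := hcon
    have hcy : ∀ n, ∃ w, x ∈ cyl T K n w := by
      intro n
      by_contra hh
      exact h0 (mem_iUnion.2 ⟨n, hx, fun h => hh (mem_iUnion.1 h)⟩)
    have h1' : 2 * ((Finset.range M).filter fun i => x ∈ Sh i).card < M := not_le.1 h1
    have hns : ∀ i, x ∉ Sh i → ∃ j < q, x ∈ GG T K (n i) (J j) := by
      intro i hi
      obtain ⟨w, hw⟩ := hcy (n i)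
      have hv : 3 / (q:ℝ) ≤ volume.real (T^[n i] '' cyl T K (n i) w) := by
        by_contra hh
        exact hi ⟨w, hw, not_le.1 hh⟩
      obtain ⟨j, hj, hj2⟩ := grid_in (P.cylBranch (n i) w).image_ord (P.image_sub _ w) hq hv
      exact ⟨j, hj, w, hw, hj2⟩
    have hpig : ∃ j < q, L ≤ ((Finset.range M).filter fun i => x ∈ GG T K (n i) (J j)).card := by
      by_contra! hh
      have h3 : (Finset.range M).filter (fun i => x ∉ Sh i) ⊆
          (Finset.range q).biUnion fun j => (Finset.range M).filter fun i => x ∈ GG T K (n i) (J j) := by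
        intro i hi
        obtain ⟨hi1, hi2⟩ := Finset.mem_filter.1 hi
        obtain ⟨j, hj, hj2⟩ := hns i hi2
        exact Finset.mem_biUnion.2 ⟨j, Finset.mem_range.2 hj, Finset.mem_filter.2 ⟨hi1, hj2⟩⟩
      have h4 := (Finset.card_le_card h3).trans (Finset.card_biUnion_le_card_mul _ _ L
        (fun j hj => (hh j (Finset.mem_range.1 hj)).le))
      have h5 := Finset.card_filter_add_card_filter_not (s := Finset.range M) (fun i => x ∈ Sh i)
      rw [Finset.card_range] at h4 h5
      have h6 : M = 2 * (q * L) := by rw [hM]; ring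
      omega
    obtain ⟨j, hj, hjL⟩ := hpig
    refine ⟨j, hj, fun y hy => ?_⟩
    rw [mem_Icc, div_le_iff₀ hq', le_div_iff₀ hq'] at hy
    have hz0 : 0 ≤ (y * q - j) * 2 ^ k := mul_nonneg (by linarith [hy.1]) (by positivity)
    have hf1 := Nat.floor_le hz0
    have hf2 := Nat.lt_floor_add_one ((y * q - j) * 2 ^ k)
    set r := ⌊(y * q - j) * 2 ^ k⌋₊
    have hr : r < 2 ^ k := by
      have h7 : (0:ℝ) < 2 ^ k := by positivity
      have : (r:ℝ) < 2 ^ k := by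
        nlinarith [hy.2]
      exact_mod_cast this
    have hyB : y ∈ B j r := by
      rw [hB]
      simp only [mem_Icc]
      rw [div_le_iff₀ hq', le_div_iff₀ hq']
      have g1 : (r:ℝ) / 2 ^ k ≤ y * q - j := by rw [div_le_iff₀ (by positivity)]; exact hf1
      have g2 : y * q - j ≤ ((r:ℝ) + 1) / 2 ^ k := by rw [le_div_iff₀ (by positivity)]; exact hf2.le
      constructor <;> linarith
    have hE : x ∉ E2 j r := fun h => h2 (mem_biUnion (Finset.mem_range.2 hj) (mem_biUnion (Finset.mem_range.2 hr) h))
    have : ∃ i < M, x ∈ GG T K (n i) (J j) ∧ x ∉ Miss T K (n i) k (B j r) := by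
      by_contra! hh
      exact hE ⟨hx, hjL, hh⟩
    obtain ⟨i, hi, -, hi2⟩ := this
    obtain ⟨w, hw⟩ := hcy (n i + k)
    have : ∃ z ∈ cyl T K (n i + k) w, T^[n i] z ∈ B j r := by
      by_contra! hh
      exact hi2 ⟨w, hw, hh⟩
    obtain ⟨z, hz, hzB⟩ := this
    have hclose := P.cyl_close (n i) k w hw hz
    refine ⟨n i, ?_, ?_, ?_⟩
    · simp only [hn]; nlinarith
    · simp only [hn]
      calc (M + i) * k ≤ (M + M) * k := by gcongr
        _ = _ := by rw [hM, hL]; ring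
    · have h8 : |T^[n i] x - T^[n i] z| ≤ (1 / 2 : ℝ) ^ k := by
        have h9 : (2:ℝ) ^ k ≤ lam ^ k := by gcongr
        rw [one_div, inv_pow, ← one_div, le_div_iff₀ (by positivity)]
        nlinarith [abs_nonneg (T^[n i] x - T^[n i] z)]
      have h10 : |T^[n i] z - y| ≤ (1 / 2 : ℝ) ^ k := by
        have h11 : ((j + ((r:ℝ) + 1) / 2 ^ k) / q) - ((j + r / 2 ^ k) / q) ≤ (1 / 2 : ℝ) ^ k := by
          have : ((j + ((r:ℝ) + 1) / 2 ^ k) / q) - ((j + r / 2 ^ k) / q) = (1 / 2 : ℝ) ^ k / q := by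
            rw [one_div, inv_pow]; field_simp; ring
          rw [this]
          apply div_le_self (by positivity)
          exact_mod_cast hq
        rw [abs_le]
        constructor <;> linarith [hzB.1, hzB.2, hyB.1, hyB.2]
      calc _ ≤ |T^[n i] x - T^[n i] z| + |T^[n i] z - y| := abs_sub_le _ _ _
        _ ≤ _ := by linarith
  refine (measure_mono hsub).trans ((measure_union_le _ _).trans ?_)
  rw [hE0v, zero_add]
  refine (measure_union_le _ _).trans ?_
  refine add_le_add ?_ ?_
  · have hm := count_markov Sh hShm _ hShv M hM0
    refine le_trans (measure_mono ?_) hm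
    intro x hx
    change M ≤ _ at hx
    change M ≤ _
    convert hx
  · refine (measure_biUnion_finset_le _ _).trans ?_
    calc _ ≤ ∑ j ∈ Finset.range q, (2 ^ k * ENNReal.ofReal (Real.exp (-(k ^ 2 / (q * cst lam D))))) := by
          refine Finset.sum_le_sum fun j _ => (measure_biUnion_finset_le _ _).trans ?_
          calc _ ≤ ∑ r ∈ Finset.range (2 ^ k), ENNReal.ofReal (Real.exp (-(k ^ 2 / (q * cst lam D)))) :=
                Finset.sum_le_sum fun r hr => hE2v j r (Finset.mem_range.1 hr)
            _ = _ := by simp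
      _ = _ := by simp

lemma tail_tendsto (q : ℕ) {a : ℝ} (ha : 0 < a) (δ : ENNReal) :
    Tendsto (fun k : ℕ => δ + q * (2 ^ k * ENNReal.ofReal (Real.exp (-(k ^ 2 / a))))) atTop (nhds δ) := by
  have h1 : Tendsto (fun k : ℕ => (2:ℝ) ^ k * Real.exp (-((k:ℝ) ^ 2 / a))) atTop (nhds 0) := by
    have h2 : Tendsto (fun k : ℕ => Real.exp ((k:ℝ) * (1 - k / a))) atTop (nhds 0) := by
      apply Real.tendsto_exp_atBot.comp
      apply Tendsto.atTop_mul_atBot₀ tendsto_natCast_atTop_atTop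
      apply tendsto_atBot_add_const_left _ 1
      exact tendsto_neg_atTop_atBot.comp (tendsto_natCast_atTop_atTop.atTop_div_const ha)
    refine squeeze_zero (fun k => by positivity) (fun k => ?_) h2
    have h3 : (2:ℝ) ^ k ≤ Real.exp k := by
      have := Real.add_one_le_exp (1:ℝ)
      rw [← Real.exp_one_pow]
      gcongr; linarith
    calc _ ≤ Real.exp k * Real.exp (-((k:ℝ) ^ 2 / a)) := by gcongr
      _ = _ := by rw [← Real.exp_add]; congr 1; ring
  have h4 := ENNReal.tendsto_ofReal h1
  rw [ENNReal.ofReal_zero] at h4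
  have h5 : Tendsto (fun k : ℕ => (q:ENNReal) * (2 ^ k * ENNReal.ofReal (Real.exp (-(k ^ 2 / a))))) atTop (nhds 0) := by
    have := ENNReal.Tendsto.const_mul (a := (q:ENNReal)) h4 (Or.inr (by simp))
    rw [mul_zero] at this
    refine this.congr fun k => ?_
    rw [ENNReal.ofReal_mul (by positivity), ENNReal.ofReal_pow (by norm_num)]
    norm_num
  simpa using tendsto_const_nhds.add h5

lemma ae_good [Fintype ι] (P : PW T K lam D) (hlam : 4 * cst lam D ≤ lam) :
    ∀ᵐ x, x ∈ Icc (0:ℝ) 1 → ∃ q : ℕ, 0 < q ∧ ∃ᶠ k in atTop, Good T q k x := by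
  obtain ⟨C, hC, hY⟩ := P.Y_bound hlam
  have hc := P.one_le_cst
  have hb : ∀ q : ℕ, 0 < q → volume {x ∈ Icc (0:ℝ) 1 | ∀ᶠ k in atTop, ¬ Good T q k x} ≤ 2 * ENNReal.ofReal (C * (3 / q)) := by
    intro q hq
    have hq' : (0:ℝ) < q := by exact_mod_cast hq
    set A : ℕ → Set ℝ := fun k0 => {x ∈ Icc (0:ℝ) 1 | ∀ k ≥ k0, ¬ Good T q k x} with hA
    have hmono : Monotone A := fun a b hab x hx => ⟨hx.1, fun k hk => hx.2 k (hab.trans hk)⟩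
    have hU : {x ∈ Icc (0:ℝ) 1 | ∀ᶠ k in atTop, ¬ Good T q k x} = ⋃ k0, A k0 := by
      ext x; simp [hA, eventually_atTop]
    rw [hU, hmono.measure_iUnion]
    refine iSup_le fun k0 => ?_
    refine ge_of_tendsto (tail_tendsto q (a := q * cst lam D) (by positivity) _) ?_
    filter_upwards [eventually_ge_atTop (max k0 1)] with k hk
    have hs : A k0 ⊆ {x ∈ Icc (0:ℝ) 1 | ¬ Good T q k x} := fun x hx => ⟨hx.1, hx.2 k (le_of_max_le_left hk)⟩
    exact (measure_mono hs).trans (P.level (by linarith) hY hq (le_of_max_le_right hk))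
  have hz : volume {x | ¬ (x ∈ Icc (0:ℝ) 1 → ∃ q : ℕ, 0 < q ∧ ∃ᶠ k in atTop, Good T q k x)} = 0 := by
    have ht : Tendsto (fun q : ℕ => 2 * ENNReal.ofReal (C * (3 / (q:ℝ)))) atTop (nhds 0) := by
      have h1 : Tendsto (fun q : ℕ => C * (3 / (q:ℝ))) atTop (nhds 0) := by
        have := (tendsto_const_div_atTop_nhds_zero_nat (3:ℝ)).const_mul C
        simpa using this
      have h2 := ENNReal.tendsto_ofReal h1
      rw [ENNReal.ofReal_zero] at h2
      have := ENNReal.Tendsto.const_mul (a := 2) h2 (Or.inr (by simp))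
      simpa using this
    refine le_antisymm (ge_of_tendsto ht ?_) zero_le
    filter_upwards [eventually_gt_atTop 0] with q hq
    refine (measure_mono ?_).trans (hb q hq)
    intro x hx
    change ¬ (_ → _) at hx
    push Not at hx
    exact ⟨hx.1, hx.2 q hq⟩
  exact hz

lemma ae_dense [Fintype ι] (P : PW T K lam D) (hlam : 4 * cst lam D ≤ lam) :
    ∀ᵐ x, x ∈ Icc (0:ℝ) 1 → ∃ q : ℕ, 0 < q ∧ ∃ u v : ℝ, 0 ≤ u ∧ u < v ∧ v ≤ 1 ∧ ∃ᶠ k : ℕ in atTop,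
      ∀ y ∈ Icc u v, ∃ n, k ≤ n ∧ n ≤ 4 * q * k ^ 3 * 2 ^ k ∧ |T^[n] x - y| ≤ 2 * (1 / 2 : ℝ) ^ k := by
  filter_upwards [P.ae_good hlam] with x hx hx1
  obtain ⟨q, hq, hf⟩ := hx hx1
  have hq' : (0:ℝ) < q := by exact_mod_cast hq
  refine ⟨q, hq, ?_⟩
  by_contra hcon
  apply hf
  have h1 : ∀ j ∈ Finset.range q, ∀ᶠ k : ℕ in atTop, ¬ ∀ y ∈ Icc ((j:ℝ) / q) ((j + 1 / 2) / q), ∃ n, k ≤ n ∧ n ≤ 4 * q * k ^ 3 * 2 ^ k ∧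
    |T^[n] x - y| ≤ 2 * (1 / 2 : ℝ) ^ k := by
    intro j hj
    by_contra hh
    have hj' : (j:ℝ) + 1 ≤ q := by exact_mod_cast Finset.mem_range.1 hj
    refine hcon ⟨(j:ℝ) / q, (j + 1 / 2) / q, by positivity, ?_, ?_, hh⟩
    · gcongr; linarith
    · rw [div_le_one hq']; linarith
  have h2 := (Finset.eventually_all (Finset.range q)).2 h1
  filter_upwards [h2] with k hk
  rintro ⟨j, hj, h⟩
  exact hk j (Finset.mem_range.2 hj) h

end PW

lemma piece_branch (T : ℝ → ℝ) (hT : Set.MapsTo T (Set.Icc (0:ℝ) 1) (Set.Icc (0:ℝ) 1)) {a b lam : ℝ}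
    (ha : 0 ≤ a) (hb : b ≤ 1) (hlam : 1 < lam) {U : Set ℝ} (hU : IsOpen U) (hIU : Icc a b ⊆ U)
    {g : ℝ → ℝ} (hg : ContDiffOn ℝ 2 g U) (hgT : ∀ x ∈ Ico a b, g x = T x)
    (hexp : ∀ x ∈ U, lam ≤ |deriv g x|) : ∃ D : ℝ, 0 ≤ D ∧ Branch T (Ioo a b) lam D := by
  have hl0 : 0 < lam := by linarith
  have hVU : Ioo a b ⊆ U := Ioo_subset_Icc_self.trans hIU
  have hgd : ∀ x ∈ U, DifferentiableAt ℝ g x := fun x hx =>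
    (hg.differentiableOn (by norm_num)).differentiableAt (hU.mem_nhds hx)
  have hev : ∀ x ∈ Ioo a b, T =ᶠ[nhds x] g := by
    intro x hx
    filter_upwards [isOpen_Ioo.mem_nhds hx] with y hy
    exact (hgT y (Ioo_subset_Ico_self hy)).symm
  have hder : ∀ x ∈ Ioo a b, deriv T x = deriv g x := fun x hx => (hev x hx).deriv_eq
  have hTd : ∀ x ∈ Ioo a b, DifferentiableAt ℝ T x := fun x hx =>
    (hgd x (hVU hx)).congr_of_eventuallyEq (hev x hx)
  have hg1 : ContDiffOn ℝ 1 (deriv g) U := hg.deriv_of_isOpen hU (by norm_num)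
  have hg1d : ∀ x ∈ U, DifferentiableAt ℝ (deriv g) x := fun x hx =>
    (hg1.differentiableOn (by norm_num)).differentiableAt (hU.mem_nhds hx)
  have hg2 : ContinuousOn (deriv (deriv g)) U := hg1.continuousOn_deriv_of_isOpen hU (by norm_num)
  obtain ⟨Λ0, hΛ0⟩ := isCompact_Icc.exists_bound_of_continuousOn (hg2.mono hIU)
  set Λ := max Λ0 0
  have hΛn : 0 ≤ Λ := le_max_right _ _
  have hΛ : ∀ x ∈ Icc a b, ‖deriv (deriv g) x‖ ≤ Λ := fun x hx => (hΛ0 x hx).trans (le_max_left _ _)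
  have hlip : ∀ x ∈ Ioo a b, ∀ y ∈ Ioo a b, |deriv g x - deriv g y| ≤ Λ * |x - y| := by
    intro x hx y hy
    exact (convex_Icc a b).norm_image_sub_le_of_norm_deriv_le (fun z hz => hg1d z (hIU hz)) hΛ
      (Ioo_subset_Icc_self hy) (Ioo_subset_Icc_self hx)
  have hcont : ContinuousOn T (Ioo a b) := fun x hx => (hTd x hx).continuousAt.continuousWithinAt
  have hexlt : ∀ x ∈ Ioo a b, ∀ y ∈ Ioo a b, x < y → lam * |x - y| ≤ |T x - T y| := by
    intro x hx y hy hxy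
    have hsub : Icc x y ⊆ Ioo a b := ordConnected_Ioo.out hx hy
    obtain ⟨z, hz, hz2⟩ := exists_deriv_eq_slope T hxy (hcont.mono hsub)
      (fun z hz => (hTd z (hsub (Ioo_subset_Icc_self hz))).differentiableWithinAt)
    have hzV := hsub (Ioo_subset_Icc_self hz)
    have h1 := hexp z (hVU hzV)
    rw [← hder z hzV, hz2, abs_div, le_div_iff₀ (abs_pos.2 (by linarith))] at h1
    rw [abs_sub_comm x y, abs_sub_comm (T x)]
    exact h1
  have hexp2 : ∀ x ∈ Ioo a b, ∀ y ∈ Ioo a b, lam * |x - y| ≤ |T x - T y| := by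
    intro x hx y hy
    rcases lt_trichotomy x y with h | h | h
    · exact hexlt x hx y hy h
    · subst h; simp
    · rw [abs_sub_comm x y, abs_sub_comm (T x)]
      exact hexlt y hy x hx h
  have hne : ∀ x ∈ Ioo a b, deriv g x ≠ 0 := by
    intro x hx h0
    have := hexp x (hVU hx)
    rw [h0, abs_zero] at this
    linarith
  refine ⟨Λ / lam ^ 2, by positivity, ?_⟩
  refine { isOpen := isOpen_Ioo, ord := ordConnected_Ioo, sub := Ioo_subset_Ioo ha hb, maps := ?_, mono := ?_, diff := hTd, expd := ?_, dist := ?_ }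
  · intro x hx
    exact hT ⟨ha.trans hx.1.le, hx.2.le.trans hb⟩
  · by_cases hpos : ∀ x ∈ Ioo a b, 0 < deriv g x
    · left
      apply strictMonoOn_of_deriv_pos (convex_Ioo a b) hcont
      intro x hx
      rw [interior_Ioo] at hx
      rw [hder x hx]; exact hpos x hx
    · right
      push Not at hpos
      obtain ⟨x0, hx0, hx0n⟩ := hpos
      apply strictAntiOn_of_deriv_neg (convex_Ioo a b) hcont
      intro x hx
      rw [interior_Ioo] at hx
      rw [hder x hx]
      by_contra hh
      push Not at hh
      have hcg : ContinuousOn (deriv g) (Ioo a b) := hg1.continuousOn.mono hVU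
      obtain ⟨z, hz, hz0⟩ := (isPreconnected_Ioo (a := a) (b := b)).intermediate_value hx0 hx hcg ⟨hx0n, hh⟩
      exact hne z hz hz0
  · intro x hx; rw [hder x hx]; exact hexp x (hVU hx)
  · intro x hx y hy
    rw [hder x hx, hder y hy]
    have h1 := hlip x hx y hy
    have h2 := hexp2 x hx y hy
    have h3 := hexp y (hVU hy)
    have h4 : |deriv g x| ≤ |deriv g y| + Λ * |x - y| := by
      have := abs_sub_abs_le_abs_sub (deriv g x) (deriv g y)
      linarith
    have h5 : Λ * |x - y| ≤ Λ / lam ^ 2 * |T x - T y| * |deriv g y| := by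
      calc Λ * |x - y| = Λ / lam ^ 2 * (lam * |x - y|) * lam := by field_simp
        _ ≤ Λ / lam ^ 2 * |T x - T y| * |deriv g y| := by gcongr
    have h6 := Real.add_one_le_exp (Λ / lam ^ 2 * |T x - T y|)
    nlinarith [abs_nonneg (deriv g y)]

lemma base_PW (T : ℝ → ℝ) (hT : Set.MapsTo T (Set.Icc (0:ℝ) 1) (Set.Icc (0:ℝ) 1))
    (m : ℕ) (a : ℕ → ℝ) (ha0 : a 0 = 0) (ham : a m = 1)
    (hasm : ∀ i < m, a i < a (i + 1)) (lam : ℝ) (hlam : 1 < lam)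
    (hpiece : ∀ i < m, ∃ U : Set ℝ, IsOpen U ∧ Set.Icc (a i) (a (i + 1)) ⊆ U ∧
      ∃ Ti : ℝ → ℝ, ContDiffOn ℝ 2 Ti U ∧
        (∀ x ∈ Set.Ico (a i) (a (i + 1)), Ti x = T x) ∧
        ∀ x ∈ U, lam ≤ |deriv Ti x|) :
    ∃ D, PW T (fun i : Fin m => Ioo (a i) (a (i + 1))) lam D := by
  have hmono : ∀ i j, i ≤ j → j ≤ m → a i ≤ a j := by
    intro i j hij
    induction j, hij using Nat.le_induction with
    | base => intro _; exact le_rfl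
    | succ j hij ih => intro hj; exact (ih (by omega)).trans (hasm j (by omega)).le
  have hbr : ∀ i : Fin m, ∃ D : ℝ, 0 ≤ D ∧ Branch T (Ioo (a i) (a (i + 1))) lam D := by
    rintro ⟨i, hi⟩
    obtain ⟨U, hU, hIU, g, hg, hgT, hexp⟩ := hpiece i hi
    exact piece_branch T hT (by rw [← ha0]; exact hmono 0 i (by omega) (by omega))
      (by rw [← ham]; exact hmono _ _ (by omega) le_rfl) hlam hU hIU hg hgT hexp
  choose Ds hDs hbr using hbr
  refine ⟨∑ i, Ds i, hlam, Finset.sum_nonneg fun i _ => hDs i, fun i => (hbr i).weaken ?_, ?_, ?_⟩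
  · exact Finset.single_le_sum (f := Ds) (fun i _ => hDs i) (Finset.mem_univ i)
  · have : ∀ i j : Fin m, i < j → Disjoint (Ioo (a i) (a (i + 1))) (Ioo (a j) (a (j + 1))) := by
      intro i j hij
      rw [Set.disjoint_left]
      intro x hx hx'
      have h1 := hmono (i + 1) j hij j.2.le
      linarith [hx.2, hx'.1]
    intro i j hij
    rcases lt_or_gt_of_ne hij with h | h
    · exact this i j h
    · exact (this j i h).symm
  · refine ((Set.finite_Iic m).image a).countable.mono ?_
    rintro x ⟨hx, hx2⟩
    by_contra hna
    have hna' : ∀ i ≤ m, a i ≠ x := fun i hi h => hna ⟨i, hi, h⟩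
    apply hx2
    have hlt : x < a m := lt_of_le_of_ne (by rw [ham]; exact hx.2) (hna' m le_rfl).symm
    classical
    have hex : ∃ n, x < a n := ⟨m, hlt⟩
    have h1 := Nat.find_spec hex
    have h2 : Nat.find hex ≤ m := Nat.find_min' hex hlt
    rcases h : Nat.find hex with _ | n
    · rw [h, ha0] at h1; exact absurd hx.1 (not_le.2 h1)
    · rw [h] at h1 h2
      have h3 : ¬ x < a n := Nat.find_min hex (by omega)
      exact mem_iUnion.2 ⟨⟨n, h2⟩, lt_of_le_of_ne (not_lt.1 h3) (hna' n (by omega)), h1⟩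

lemma exists_iter {ι : Type} [Fintype ι] {T : ℝ → ℝ} {K : ι → Set ℝ} {lam D : ℝ} (P : PW T K lam D) :
    ∃ p : ℕ, p ≠ 0 ∧ 4 * PW.cst (lam ^ p) (D * lam / (lam - 1)) ≤ lam ^ p := by
  have hD := P.Dinf_nonneg
  have h1 := P.one_lt
  set D' := D * lam / (lam - 1)
  obtain ⟨p, hp⟩ := pow_unbounded_of_one_lt (4 * Real.exp (D' * (lam / (lam - 1))) ^ 2 + lam) h1
  have hexp : 0 < Real.exp (D' * (lam / (lam - 1))) ^ 2 := by positivity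
  have hp1 : lam < lam ^ p := by linarith
  refine ⟨p, ?_, ?_⟩
  · rintro rfl; rw [pow_zero] at hp1; linarith
  · have : PW.cst (lam ^ p) D' ≤ Real.exp (D' * (lam / (lam - 1))) ^ 2 := by
      unfold PW.cst
      rw [mul_div_assoc]
      gcongr ?_ ^ 2
      apply Real.exp_le_exp.2
      gcongr D' * ?_
      rw [div_le_div_iff₀ (by linarith) (by linarith)]
      nlinarith
    linarith

lemma size_tendsto (Q : ℕ) {θ : ℝ} (hθ0 : 0 ≤ θ) (hθ : θ < 1) :
    Tendsto (fun k : ℕ => 2 * (1 / 2 : ℝ) ^ k * ((Q * k ^ 3 * 2 ^ k : ℕ) : ℝ) ^ θ) atTop (nhds 0) := by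
  have hr : |(2:ℝ) ^ θ / 2| < 1 := by
    rw [abs_of_nonneg (by positivity), div_lt_one (by norm_num)]
    calc (2:ℝ) ^ θ < 2 ^ (1:ℝ) := Real.rpow_lt_rpow_of_exponent_lt (by norm_num) hθ
      _ = 2 := by simp
  have h1 := (tendsto_pow_const_mul_const_pow_of_abs_lt_one 3 hr).const_mul (2 * (Q:ℝ) ^ θ)
  rw [mul_zero] at h1
  refine squeeze_zero' (Eventually.of_forall fun k => by positivity) ?_ h1
  filter_upwards [eventually_ge_atTop 1] with k hk
  have hk1 : (1:ℝ) ≤ k := by exact_mod_cast hk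
  push_cast
  rw [Real.mul_rpow (by positivity) (by positivity), Real.mul_rpow (by positivity) (by positivity)]
  have h2 : ((k:ℝ) ^ 3) ^ θ ≤ (k:ℝ) ^ 3 := by
    calc ((k:ℝ) ^ 3) ^ θ ≤ ((k:ℝ) ^ 3) ^ (1:ℝ) := Real.rpow_le_rpow_of_exponent_le (one_le_pow₀ hk1) hθ.le
      _ = _ := by simp
  have h3 : ((2:ℝ) ^ k) ^ θ = ((2:ℝ) ^ θ) ^ k := by
    rw [← Real.rpow_natCast, ← Real.rpow_mul (by norm_num), mul_comm, Real.rpow_mul (by norm_num), Real.rpow_natCast]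
  rw [h3]
  calc _ ≤ 2 * (1 / 2 : ℝ) ^ k * ((Q:ℝ) ^ θ * (k:ℝ) ^ 3 * ((2:ℝ) ^ θ) ^ k) := by gcongr
    _ = _ := by rw [div_pow, div_pow]; ring

theorem stmt_4
    (T : ℝ → ℝ) (hT : Set.MapsTo T (Set.Icc (0:ℝ) 1) (Set.Icc (0:ℝ) 1))
    -- the finite partition of [0,1] into intervals, with endpoints a 0 < a 1 < ⋯ < a m
    (m : ℕ) (hm : 0 < m) (a : ℕ → ℝ) (ha0 : a 0 = 0) (ham : a m = 1)
    (hasm : ∀ i < m, a i < a (i + 1))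
    -- piecewise C² and uniformly expanding: on each partition interval T extends to a C² map
    -- on a neighbourhood of its closure, with |T′| ≥ λ > 1 everywhere
    (lam : ℝ) (hlam : 1 < lam)
    (hpiece : ∀ i < m, ∃ U : Set ℝ, IsOpen U ∧ Set.Icc (a i) (a (i + 1)) ⊆ U ∧
      ∃ Ti : ℝ → ℝ, ContDiffOn ℝ 2 Ti U ∧
        (∀ x ∈ Set.Ico (a i) (a (i + 1)), Ti x = T x) ∧
        ∀ x ∈ U, lam ≤ |deriv Ti x|)
    -- weakly covering, where W is the set of points whose forward orbit never hits the
    -- endpoints of the partition intervals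
    (W : Set ℝ)
    (hW : W = {x : ℝ | ∀ n : ℕ, ∀ i ≤ m, T^[n] x ≠ a i})
    (N₀ : ℕ)
    (hcov : ∀ i < m,
      Set.Icc (0:ℝ) 1 \ W ⊆ ⋃ k ≤ N₀, T^[k] '' Set.Ico (a i) (a (i + 1)))
    -- the sequence of radii
    (α : ℝ) (hα : 1 ≤ α)
    (r : ℕ → ℝ) (hr : ∀ n : ℕ, r n = (n : ℝ) ^ (-α)) :
    ∀ᵐ x ∂(volume : Measure ℝ), x ∈ Set.Icc (0:ℝ) 1 →
      dimH (hitSet T x r) = ENNReal.ofReal (1 / α) := by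
  obtain ⟨D, P⟩ := base_PW T hT m a ha0 ham hasm lam hlam hpiece
  obtain ⟨p, hp, hp4⟩ := exists_iter P
  have hα0 : 0 < α := by linarith
  filter_upwards [(P.iter hp).ae_dense hp4] with x hx hx1
  obtain ⟨q, hq, u, v, hu, huv, hv, hf⟩ := hx hx1
  apply le_antisymm
  · refine le_trans (dimH_mono ?_) (upper_dim (fun n => T^[n] x) α hα)
    rintro y ⟨-, hy⟩
    simp_rw [hr] at hy
    exact hy
  · by_contra hcon
    push Not at hcon
    obtain ⟨s, hs1, hs2⟩ := ENNReal.lt_iff_exists_nnreal_btwn.1 hcon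
    have hs0 : 0 < (s : ℝ) := by
      have : (0:ENNReal) < s := lt_of_le_of_lt zero_le hs1
      exact_mod_cast this
    have hsα : (s:ℝ) < 1 / α := by
      rw [← ENNReal.ofReal_coe_nnreal] at hs2
      exact (ENNReal.ofReal_lt_ofReal_iff_of_nonneg hs0.le).1 hs2
    have hθ : α * s < 1 := by rw [lt_div_iff₀ hα0] at hsα; linarith
    have hs3 : (s:ℝ) ≤ 1 := by nlinarith
    set Q := p * (4 * q) with hQ
    have hQ0 : 0 < Q := by positivity
    have hlow : ENNReal.ofReal s ≤ dimH {y ∈ Icc u v | ∃ᶠ n in atTop, |T^[n] x - y| < (n:ℝ)^(-α)} := by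
      refine cantor_lower (fun n => T^[n] x) u v α s huv hα hs0 hs3 ?_
      intro η hη n0
      have e1 : ∀ᶠ k : ℕ in atTop, 2 * (1 / 2 : ℝ) ^ k * ((Q * k ^ 3 * 2 ^ k : ℕ) : ℝ) ^ (α * s) < η :=
        (size_tendsto Q (by positivity) hθ).eventually (gt_mem_nhds hη)
      have e2 : ∀ᶠ k : ℕ in atTop, 2 * (1 / 2 : ℝ) ^ k < η := by
        have := (tendsto_pow_atTop_nhds_zero_of_lt_one (r := (1 / 2 : ℝ)) (by norm_num) (by norm_num)).const_mul 2
        rw [mul_zero] at this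
        exact this.eventually (gt_mem_nhds hη)
      obtain ⟨k, hk, hk1, hk2, hk3⟩ := (hf.and_eventually (e1.and (e2.and (eventually_ge_atTop (n0 + 1))))).exists
      refine ⟨Q * k ^ 3 * 2 ^ k, 2 * (1 / 2 : ℝ) ^ k, by positivity, hk1.le, ?_, hk2.le, ?_⟩
      · have hN : (2:ℝ) ^ k ≤ ((Q * k ^ 3 * 2 ^ k : ℕ) : ℝ) := by
          have : 0 < k := by omega
          have h : 1 * 2 ^ k ≤ Q * k ^ 3 * 2 ^ k := Nat.mul_le_mul_right _ (by
            have : 0 < Q * k ^ 3 := by positivity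
            omega)
          rw [one_mul] at h
          exact_mod_cast h
        have h2k : (1:ℝ) ≤ 2 ^ k := one_le_pow₀ (by norm_num)
        calc ((Q * k ^ 3 * 2 ^ k : ℕ) : ℝ) ^ (-α) ≤ ((Q * k ^ 3 * 2 ^ k : ℕ) : ℝ) ^ (-1 : ℝ) :=
              Real.rpow_le_rpow_of_exponent_le (h2k.trans hN) (by linarith)
          _ = (((Q * k ^ 3 * 2 ^ k : ℕ) : ℝ))⁻¹ := Real.rpow_neg_one _
          _ ≤ ((2:ℝ) ^ k)⁻¹ := inv_anti₀ (by positivity) hN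
          _ ≤ 2 * (1 / 2 : ℝ) ^ k := by
            rw [one_div, inv_pow]
            have : 0 < ((2:ℝ) ^ k)⁻¹ := by positivity
            linarith
      · intro y hy
        obtain ⟨n, hn1, hn2, hn3⟩ := hk y hy
        have hp1 : 1 ≤ p := Nat.one_le_iff_ne_zero.2 hp
        refine ⟨p * n, ?_, ?_, ?_⟩
        · nlinarith
        · calc p * n ≤ p * (4 * q * k ^ 3 * 2 ^ k) := Nat.mul_le_mul_left _ hn2
            _ = _ := by rw [hQ]; ring
        · rw [Function.iterate_mul]; exact hn3
    have hsub : {y ∈ Icc u v | ∃ᶠ n in atTop, |T^[n] x - y| < (n:ℝ)^(-α)} ⊆ hitSet T x r := by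
      rintro y ⟨hy, hy2⟩
      refine ⟨⟨hu.trans hy.1, hy.2.trans hv⟩, ?_⟩
      simp_rw [hr]
      exact hy2
    have := hlow.trans (dimH_mono hsub)
    rw [ENNReal.ofReal_coe_nnreal] at this
    exact absurd hs1 (not_lt.2 this)
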